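/- Let P be a non-empty Π⁰₁ class consisting only of Martin-Löf random sets, and let c be a cost function satisfying the limit condition. Then there is a Δ⁰₂ set Z ∈ P such that every computably enumerable set A with A ≤_T Z obeys c. -/

import Mathlib

/-! Basic definitions: Cantor space, initial segments, computable approximations,
Martin-Löf randomness, change counting, cost functions, oracle computability. -/

/-- The length-`n` initial segment of `Z : ℕ → Bool`, as a list of booleans. -/
def restr (Z : ℕ → Bool) (n : ℕ) : List Bool := (List.range n).map Z

/-- `σ` is an initial segment of `Z`. -/
def InitSeg (σ : List Bool) (Z : ℕ → Bool) : Prop := σ = restr Z σ.length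

/-- `Z` is Martin-Löf random: for every computable sequence of strings with
finite total measure, only finitely many are initial segments of `Z`. -/
def MLRandom (Z : ℕ → Bool) : Prop :=
  ∀ σ : ℕ → List Bool, Computable σ →
    Summable (fun i => ((1 : ℝ) / 2) ^ (σ i).length) →
    {i | InitSeg (σ i) Z}.Finite

/-- `(Zs s) s∈ℕ` converges pointwise to `Z`. -/
def Approx (Zs : ℕ → ℕ → Bool) (Z : ℕ → Bool) : Prop :=
  ∀ x, ∃ t, ∀ s, t ≤ s → Zs s x = Z x

/-- `Zs` is a computable approximation of `Z`. -/
def CompApprox (Zs : ℕ → ℕ → Bool) (Z : ℕ → Bool) : Prop :=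
  Computable₂ Zs ∧ Approx Zs Z

/-- `Z` is Δ⁰₂: it has a computable approximation. -/
def Delta02 (Z : ℕ → Bool) : Prop := ∃ Zs, CompApprox Zs Z

/-- The set of stages `s ≥ 1` at which the length-`n` initial segment of the
approximation changes. -/
def changeStages (Zs : ℕ → ℕ → Bool) (n : ℕ) : Set ℕ :=
  {s | 1 ≤ s ∧ restr (Zs s) n ≠ restr (Zs (s - 1)) n}

/-- `Z` is a `g`-change set. -/
def GChangeSet (Z : ℕ → Bool) (g : ℕ → ℕ) : Prop :=
  ∃ Zs, CompApprox Zs Z ∧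
    ∀ n, (changeStages Zs n).Finite ∧ (changeStages Zs n).ncard ≤ g n

/-- `Z` is ω-c.a.: a `g`-change set for some computable `g`. -/
def OmegaCA (Z : ℕ → Bool) : Prop := ∃ g : ℕ → ℕ, Computable g ∧ GChangeSet Z g

/-- Lexicographic order on Cantor space. -/
def LexLE (X Y : ℕ → Bool) : Prop :=
  X = Y ∨ ∃ n, (∀ i, i < n → X i = Y i) ∧ X n = false ∧ Y n = true

/-- `Z` is left-c.e. -/
def LeftCE (Z : ℕ → Bool) : Prop :=
  ∃ Zs, CompApprox Zs Z ∧ ∀ s, LexLE (Zs s) (Zs (s + 1))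

/-- `c` is a cost function: computable, nonnegative, nondecreasing in the stage,
nonincreasing in the number. -/
def CostFunction (c : ℕ → ℕ → ℚ) : Prop :=
  Computable₂ c ∧ (∀ x s, 0 ≤ c x s) ∧
    (∀ x s t, s ≤ t → c x s ≤ c x t) ∧ (∀ x y s, x ≤ y → c y s ≤ c x s)

/-- The limit condition for a cost function. -/
def LimitCondition (c : ℕ → ℕ → ℚ) : Prop :=
  ∀ ε : ℚ, 0 < ε → ∃ x₀, ∀ x, x₀ ≤ x → ∀ s, c x s ≤ ε

/-- A benign cost function: the number of pairwise disjoint intervals `[x,s)` with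
`c x s ≥ 2^{-k}` is computably bounded in `k`. -/
def Benign (c : ℕ → ℕ → ℚ) : Prop :=
  ∃ b : ℕ → ℕ, Computable b ∧
    ∀ k m (x s : ℕ → ℕ), (∀ i, i < m → x i < s i) →
      (∀ i, i + 1 < m → s i ≤ x (i + 1)) →
      (∀ i, i < m → ((1 : ℚ) / 2) ^ k ≤ c (x i) (s i)) → m ≤ b k

open Classical in
/-- The cost paid at stage `s` by the approximation `As`: if `s ≥ 1` and the
approximation changes at `s`, it is `c x s` where `x` is the least changed number. -/
noncomputable def stageCost (c : ℕ → ℕ → ℚ) (As : ℕ → ℕ → Bool) (s : ℕ) : ℚ :=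
  if s = 0 then 0
  else if h : ∃ x, As s x ≠ As (s - 1) x then c (Nat.find h) s else 0

/-- `A` obeys the cost function `c`: some computable approximation of `A` has
finite total cost. -/
def Obeys (A : ℕ → Bool) (c : ℕ → ℕ → ℚ) : Prop :=
  ∃ As, CompApprox As A ∧ ∃ B : ℚ, ∀ F : Finset ℕ, ∑ s ∈ F, stageCost c As s ≤ B

/-- Functions partial recursive in the oracle `O`. -/
inductive RecIn (O : ℕ →. ℕ) : (ℕ →. ℕ) → Prop
  | oracle : RecIn O O
  | zero : RecIn O (pure 0)
  | succ : RecIn O ↑Nat.succ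
  | left : RecIn O ↑fun n : ℕ => n.unpair.1
  | right : RecIn O ↑fun n : ℕ => n.unpair.2
  | pair {f g} : RecIn O f → RecIn O g → RecIn O fun n => Nat.pair <$> f n <*> g n
  | comp {f g} : RecIn O f → RecIn O g → RecIn O fun n => g n >>= f
  | prec {f g} : RecIn O f → RecIn O g → RecIn O (Nat.unpaired fun a n =>
      n.rec (f a) fun y IH => do let i ← IH; g (Nat.pair a (Nat.pair y i)))
  | rfind {f} : RecIn O f → RecIn O fun a =>
      Nat.rfind fun n => (fun m => m = 0) <$> f (Nat.pair a n)

/-- The characteristic function of `A` as a partial function ℕ →. ℕ. -/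
def charFn (A : ℕ → Bool) : ℕ →. ℕ := fun n => Part.some (cond (A n) 1 0)

/-- Turing reducibility: `A ≤_T Z`. -/
def TuringLE (A Z : ℕ → Bool) : Prop := RecIn (charFn Z) (charFn A)

/-- `A` is computably enumerable: the domain of a partial computable function. -/
def CE (A : ℕ → Bool) : Prop :=
  ∃ f : ℕ →. ℕ, Nat.Partrec f ∧ ∀ x, A x = true ↔ (f x).Dom

/-- A Π⁰₁ class of elements of Cantor space. -/
def Pi01 (P : Set (ℕ → Bool)) : Prop :=
  ∃ f : ℕ → Option (List Bool), Computable f ∧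
    P = {Z | ∀ i σ, f i = some σ → ¬ InitSeg σ Z}

/-- The c.e. set `W_e`: the domain of the `e`-th partial computable function. -/
def Wset (e : ℕ) : Set ℕ :=
  {x | ((Denumerable.ofNat Nat.Partrec.Code e).eval x).Dom}

/-- The stage-`s` approximation to `W_e`, via step-bounded evaluation. -/
def WAt (e s x : ℕ) : Prop :=
  (Nat.Partrec.Code.evaln s (Denumerable.ofNat Nat.Partrec.Code e) x).isSome

/-- `A` is promptly simple. -/
def PromptlySimple (A : ℕ → Bool) : Prop :=
  CE A ∧ {x | A x = false}.Infinite ∧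
    ∃ As : ℕ → ℕ → Bool, Computable₂ As ∧
      (∀ s x, As s x = true → As (s + 1) x = true) ∧
      (∀ x, A x = true ↔ ∃ s, As s x = true) ∧
      ∀ e, (Wset e).Infinite →
        ∃ s x, 1 ≤ s ∧ WAt e s x ∧ ¬ WAt e (s - 1) x ∧ As s x = true


/-! ### Computability toolkit -/

theorem comp_count {α : Type*} [Primcodable α] {p : α → ℕ → Bool} (hp : Computable₂ p)
    {N : α → ℕ} (hN : Computable N) :
    Computable fun a => Nat.count (fun k => p a k = true) (N a) := by
  have h : Computable₂ (fun (a : α) (q : ℕ × ℕ) => q.2 + (bif p a q.1 then 1 else 0)) :=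
    (Primrec.nat_add.to_comp).comp (Computable.snd.comp Computable.snd)
      (Computable.cond (hp.comp Computable.fst (Computable.fst.comp Computable.snd))
        (Computable.const 1) (Computable.const 0))
  refine (Computable.nat_rec hN (Computable.const 0) h).of_eq fun a => ?_
  induction N a with
  | zero => simp
  | succ n ih =>
    simp only [Nat.count_succ, ← ih]
    cases p a n <;> simp

theorem comp_ball {α : Type*} [Primcodable α] {p : α → ℕ → Bool} (hp : Computable₂ p)
    {N : α → ℕ} (hN : Computable N) :
    Computable fun a => decide (∀ x < N a, p a x = true) := by
  have h : Computable₂ (fun (a : α) (q : ℕ × Bool) => q.2 && p a q.1) :=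
    (Primrec.and.to_comp).comp (Computable.snd.comp Computable.snd)
      (hp.comp Computable.fst (Computable.fst.comp Computable.snd))
  refine (Computable.nat_rec hN (Computable.const true) h).of_eq fun a => ?_
  induction N a with
  | zero => simp
  | succ n ih =>
    simp only [ih, Nat.forall_lt_succ_right]
    cases p a n <;> simp

theorem comp_not {α : Type*} [Primcodable α] {p : α → Bool} (hp : Computable p) :
    Computable fun a => !(p a) := Primrec.not.to_comp.comp hp

theorem comp_and {α : Type*} [Primcodable α] {p q : α → Bool} (hp : Computable p)
    (hq : Computable q) : Computable fun a => p a && q a := Primrec.and.to_comp.comp hp hq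

theorem comp_or {α : Type*} [Primcodable α] {p q : α → Bool} (hp : Computable p)
    (hq : Computable q) : Computable fun a => p a || q a := Primrec.or.to_comp.comp hp hq

theorem comp_bex {α : Type*} [Primcodable α] {p : α → ℕ → Bool} (hp : Computable₂ p)
    {N : α → ℕ} (hN : Computable N) :
    Computable fun a => decide (∃ x < N a, p a x = true) := by
  have h : Computable₂ fun a x => !(p a x) := comp_not hp
  refine (comp_not (comp_ball h hN)).of_eq fun a => ?_
  rw [← decide_not]
  simp

theorem comp_find {α : Type*} [Primcodable α] {p : α → ℕ → Bool} (hp : Computable₂ p)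
    (h : ∀ a, ∃ n, p a n = true) : Computable fun a => Nat.find (h a) := by
  refine Partrec.of_eq_tot (Partrec.rfind hp.partrec₂) fun a => ?_
  rw [Nat.mem_rfind]
  refine ⟨?_, fun {m} hm => ?_⟩
  · simpa using (Nat.find_spec (h a)).symm
  · simpa using (Nat.find_min (h a) hm)

theorem comp_add {α : Type*} [Primcodable α] {f g : α → ℕ} (hf : Computable f)
    (hg : Computable g) : Computable fun a => f a + g a := Primrec.nat_add.to_comp.comp hf hg
theorem comp_mul {α : Type*} [Primcodable α] {f g : α → ℕ} (hf : Computable f)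
    (hg : Computable g) : Computable fun a => f a * g a := Primrec.nat_mul.to_comp.comp hf hg
theorem comp_div {α : Type*} [Primcodable α] {f g : α → ℕ} (hf : Computable f)
    (hg : Computable g) : Computable fun a => f a / g a := Primrec.nat_div.to_comp.comp hf hg
theorem comp_mod {α : Type*} [Primcodable α] {f g : α → ℕ} (hf : Computable f)
    (hg : Computable g) : Computable fun a => f a % g a := Primrec.nat_mod.to_comp.comp hf hg
theorem comp_pow {α : Type*} [Primcodable α] {f g : α → ℕ} (hf : Computable f)
    (hg : Computable g) : Computable fun a => f a ^ g a :=
  (Primrec₂.unpaired'.1 Nat.Primrec.pow).to_comp.comp hf hg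
theorem comp_pair {α : Type*} [Primcodable α] {f g : α → ℕ} (hf : Computable f)
    (hg : Computable g) : Computable fun a => Nat.pair (f a) (g a) :=
  Primrec₂.natPair.to_comp.comp hf hg
theorem comp_le {α : Type*} [Primcodable α] {f g : α → ℕ} (hf : Computable f)
    (hg : Computable g) : Computable fun a => decide (f a ≤ g a) :=
  Primrec.nat_le.decide.to_comp.comp hf hg
theorem comp_lt {α : Type*} [Primcodable α] {f g : α → ℕ} (hf : Computable f)
    (hg : Computable g) : Computable fun a => decide (f a < g a) :=
  Primrec.nat_lt.decide.to_comp.comp hf hg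
theorem comp_eq {α β : Type*} [Primcodable α] [Primcodable β] [DecidableEq β] {f g : α → β}
    (hf : Computable f) (hg : Computable g) : Computable fun a => decide (f a = g a) :=
  Primrec.eq.decide.to_comp.comp hf hg

theorem comp_testBit {α : Type*} [Primcodable α] {f g : α → ℕ} (hf : Computable f)
    (hg : Computable g) : Computable fun a => (f a).testBit (g a) := by
  refine (comp_eq (comp_mod (comp_div hf (comp_pow (Computable.const 2) hg))
    (Computable.const 2)) (Computable.const 1)).of_eq fun a => ?_
  rw [Nat.testBit_eq_decide_div_mod_eq]

theorem restr_succ (Z : ℕ → Bool) (n : ℕ) : restr Z (n + 1) = restr Z n ++ [Z n] := by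
  simp [restr, List.range_succ]

theorem comp_restr {α : Type*} [Primcodable α] {Z : α → ℕ → Bool} (hZ : Computable₂ Z)
    {N : α → ℕ} (hN : Computable N) : Computable fun a => restr (Z a) (N a) := by
  have h : Computable₂ (fun (a : α) (q : ℕ × List Bool) => q.2 ++ [Z a q.1]) :=
    Computable.list_concat.comp (Computable.snd.comp Computable.snd)
      (hZ.comp Computable.fst (Computable.fst.comp Computable.snd))
  refine (Computable.nat_rec hN (Computable.const []) h).of_eq fun a => ?_
  induction N a with
  | zero => simp [restr]
  | succ n ih => simp only [ih, restr_succ]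


/-- natural-number code of a rational (pair of code of numerator and denominator) -/
def ratCode (q : ℚ) : ℕ := Nat.pair (Equiv.intEquivNat q.num) q.den

theorem ratCode_eq (q : ℚ) : ratCode q = @Encodable.encode ℚ Rat.instEncodable q := by
  rcases q with ⟨a, b, c, d⟩
  rfl

def natAbsCode (a : ℕ) : ℕ := bif decide (a % 2 = 0) then a / 2 else a / 2 + 1

theorem natAbsCode_eq (z : ℤ) : natAbsCode (Equiv.intEquivNat z) = z.natAbs := by
  rcases z with n | n
  · have : Equiv.intEquivNat (Int.ofNat n) = 2 * n := rfl
    rw [this]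
    simp [natAbsCode]
  · have : Equiv.intEquivNat (Int.negSucc n) = 2 * n + 1 := rfl
    simp [this, natAbsCode]
    omega

def ratRange (v : ℕ) : Bool :=
  decide (0 < v.unpair.2) && decide (∀ x < v.unpair.2 + 1,
    (decide (v.unpair.2 % x = 0) && decide (natAbsCode v.unpair.1 % x = 0) → x = 1))

theorem ratRange_iff (v : ℕ) : ratRange v = true ↔ ∃ q, ratCode q = v := by
  have key : ratRange v = true ↔
      (0 < v.unpair.2 ∧ (natAbsCode v.unpair.1).Coprime v.unpair.2) := by
    simp only [ratRange, Bool.and_eq_true, decide_eq_true_eq]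
    refine and_congr_right fun h0 => ⟨fun h => ?_, fun h x hx h' => ?_⟩
    · have := h (Nat.gcd (natAbsCode v.unpair.1) v.unpair.2)
        (Nat.lt_succ_of_le (Nat.gcd_le_right _ h0))
      exact this ⟨Nat.mod_eq_zero_of_dvd (Nat.gcd_dvd_right _ _),
        Nat.mod_eq_zero_of_dvd (Nat.gcd_dvd_left _ _)⟩
    · exact Nat.eq_one_of_dvd_coprimes h (Nat.dvd_of_mod_eq_zero h'.2)
        (Nat.dvd_of_mod_eq_zero h'.1)
  rw [key]
  constructor
  · rintro ⟨h0, h1⟩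
    refine ⟨⟨Equiv.intEquivNat.symm v.unpair.1, v.unpair.2, h0.ne', ?_⟩, ?_⟩
    · rw [← natAbsCode_eq]; simpa using h1
    · simp [ratCode]
  · rintro ⟨q, rfl⟩
    simp only [ratCode, Nat.unpair_pair, natAbsCode_eq]
    exact ⟨q.den_pos, q.reduced⟩

theorem comp_ratRange : Computable ratRange := by
  have h2 : Computable fun v : ℕ => v.unpair.2 := Computable.snd.comp Computable.unpair
  have h1 : Computable fun v : ℕ => v.unpair.1 := Computable.fst.comp Computable.unpair
  have hn : Computable natAbsCode :=
    Computable.cond (comp_eq (comp_mod Computable.id (Computable.const 2)) (Computable.const 0))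
      (comp_div Computable.id (Computable.const 2))
      (comp_add (comp_div Computable.id (Computable.const 2)) (Computable.const 1))
  have hb : Computable₂ (fun (v x : ℕ) => (!(decide (v.unpair.2 % x = 0) &&
      decide (natAbsCode v.unpair.1 % x = 0))) || decide (x = 1)) :=
    comp_or (comp_not (comp_and
      (comp_eq (comp_mod (h2.comp Computable.fst) Computable.snd) (Computable.const 0))
      (comp_eq (comp_mod (hn.comp (h1.comp Computable.fst)) Computable.snd)
        (Computable.const 0)))) (comp_eq Computable.snd (Computable.const 1))
  refine (comp_and (comp_lt (Computable.const 0) h2)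
    (comp_ball hb (comp_add h2 (Computable.const 1)))).of_eq fun v => ?_
  unfold ratRange
  congr 1
  rw [decide_eq_decide]
  refine forall_congr' fun x => forall_congr' fun _ => ?_
  by_cases h : x = 1 <;> simp [h, imp_iff_not_or]

theorem ratCode_count (q : ℚ) :
    Nat.count (fun k => ratRange k = true) (ratCode q) =
      @Encodable.encode ℚ Primcodable.toEncodable q := by
  have h1 : @Encodable.encode ℚ Primcodable.toEncodable q =
      (List.range (@Encodable.encode ℚ Rat.instEncodable q)).countP
        (fun y => @decide (y ∈ Set.range (@Encodable.encode ℚ Rat.instEncodable))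
          (@Encodable.decidableRangeEncode ℚ Rat.instEncodable y)) := rfl
  rw [h1, ← ratCode_eq, Nat.count_eq_card_filter_range, List.countP_eq_length_filter]
  have h2 : ∀ y : ℕ, (@decide (y ∈ Set.range (@Encodable.encode ℚ Rat.instEncodable))
          (@Encodable.decidableRangeEncode ℚ Rat.instEncodable y)) = decide (ratRange y = true) := by
    intro y
    rw [decide_eq_decide, ratRange_iff]
    simp [ratCode_eq]
  simp only [h2]
  rfl

theorem comp_ratCode : Computable ratCode := by
  have hp : Computable₂ (fun (n v : ℕ) => ratRange v &&
      decide (Nat.count (fun k => ratRange k = true) v = n)) :=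
    comp_and (comp_ratRange.comp Computable.snd)
      (comp_eq (comp_count (p := fun (_ : ℕ × ℕ) k => ratRange k)
        (comp_ratRange.comp Computable.snd) Computable.snd) Computable.fst)
  have hex : ∀ n, ∃ v, (ratRange v &&
      decide (Nat.count (fun k => ratRange k = true) v = n)) = true := by
    intro n
    refine ⟨ratCode (Denumerable.ofNat ℚ n), ?_⟩
    simp only [Bool.and_eq_true, decide_eq_true_eq, ratCode_count]
    exact ⟨(ratRange_iff _).2 ⟨_, rfl⟩, Denumerable.encode_ofNat (α := ℚ) n⟩
  refine ((comp_find hp hex).comp Computable.encode).of_eq fun q => ?_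
  have key : ∀ v n, (ratRange v &&
      decide (Nat.count (fun k => ratRange k = true) v = n)) = true →
      n = @Encodable.encode ℚ Primcodable.toEncodable q → v = ratCode q := by
    intro v n hv hn
    simp only [Bool.and_eq_true, decide_eq_true_eq] at hv
    obtain ⟨r, rfl⟩ := (ratRange_iff _).1 hv.1
    rw [ratCode_count, hn] at hv
    rw [@Encodable.encode_injective ℚ Primcodable.toEncodable _ _ hv.2]
  exact key _ _ (Nat.find_spec (hex _)) rfl

theorem comp_rat_le {α : Type*} [Primcodable α] {f : α → ℚ} {g : α → ℕ} (hf : Computable f)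
    (hg : Computable g) (h0 : ∀ a, 0 ≤ f a) :
    Computable fun a => decide (f a ≤ (1 / 2) ^ (g a)) := by
  have hc : Computable fun a => ratCode (f a) := comp_ratCode.comp hf
  have hn : Computable natAbsCode :=
    Computable.cond (comp_eq (comp_mod Computable.id (Computable.const 2)) (Computable.const 0))
      (comp_div Computable.id (Computable.const 2))
      (comp_add (comp_div Computable.id (Computable.const 2)) (Computable.const 1))
  refine (comp_le (comp_mul (hn.comp (Computable.fst.comp (Computable.unpair.comp hc)))
    (comp_pow (Computable.const 2) hg))
    (Computable.snd.comp (Computable.unpair.comp hc))).of_eq fun a => ?_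
  rw [decide_eq_decide]
  simp only [ratCode, Nat.unpair_pair, natAbsCode_eq]
  have hnum : ((f a).num.natAbs : ℚ) = (f a).num := by
    have : ((f a).num.natAbs : ℤ) = (f a).num := Int.natAbs_of_nonneg (Rat.num_nonneg.2 (h0 a))
    rw [← Int.cast_natCast, this]
  have hd : (0 : ℚ) < (f a).den := by exact_mod_cast (f a).den_pos
  have hq : f a = ((f a).num.natAbs : ℚ) / (f a).den := by
    rw [hnum, Rat.num_div_den]
  constructor
  · intro h
    rw [hq, div_le_iff₀ hd, one_div, inv_pow, inv_mul_eq_div, le_div_iff₀ (by positivity)]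
    exact_mod_cast h
  · intro h
    rw [hq, div_le_iff₀ hd, one_div, inv_pow, inv_mul_eq_div, le_div_iff₀ (by positivity)] at h
    exact_mod_cast h


theorem restr_length (Z : ℕ → Bool) (n : ℕ) : (restr Z n).length = n := by simp [restr]

theorem restr_pre_of_le (Z : ℕ → Bool) {m n : ℕ} (h : m ≤ n) : restr Z m <+: restr Z n := by
  induction n, h using Nat.le_induction with
  | base => exact List.prefix_refl _
  | succ n _ ih => rw [restr_succ]; exact ih.trans (List.prefix_append _ _)

/-- `ψ` is a monotone computable finite-use version of the partial function `f` relative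
to `Z`. -/
def UseOf (Z : ℕ → Bool) (f : ℕ →. ℕ) (ψ : List Bool → ℕ → Option ℕ) : Prop :=
  Computable₂ ψ ∧ (∀ τ τ' x v, τ <+: τ' → ψ τ x = some v → ψ τ' x = some v) ∧
    (∀ x v, v ∈ f x → ∃ m, ∀ n, m ≤ n → ψ (restr Z n) x = some v)

theorem useOf_tot (Z : ℕ → Bool) (f : ℕ → ℕ) (hf : Computable f) :
    UseOf Z (f : ℕ →. ℕ) (fun _ x => some (f x)) := by
  refine ⟨Computable.option_some.comp (hf.comp Computable.snd), fun _ _ _ _ _ h => h, ?_⟩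
  intro x v h
  refine ⟨0, fun n _ => ?_⟩
  simp at h
  simp [h]

theorem exists_use (Z : ℕ → Bool) {f : ℕ →. ℕ} (hf : RecIn (charFn Z) f) :
    ∃ ψ, UseOf Z f ψ := by
  induction hf with
  | oracle =>
    refine ⟨fun τ x => (τ[x]?).map (fun b => cond b 1 0), ?_, ?_, ?_⟩
    · exact Computable.option_map (Computable.list_getElem?.comp Computable.fst Computable.snd)
        (Computable.cond Computable.snd (Computable.const 1) (Computable.const 0))
    · rintro τ _ x v ⟨u, rfl⟩ h
      rw [Option.map_eq_some_iff] at h ⊢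
      obtain ⟨b, hb, rfl⟩ := h
      refine ⟨b, ?_, rfl⟩
      have := (List.getElem?_eq_some_iff.1 hb).1
      rw [List.getElem?_append_left this, hb]
    · intro x v h
      simp only [charFn, Part.mem_some_iff] at h
      refine ⟨x + 1, fun n hn => ?_⟩
      simp [restr, List.getElem?_range (show x < n by omega), h]
  | zero => exact ⟨_, useOf_tot Z (fun _ => 0) (Computable.const 0)⟩
  | succ => exact ⟨_, useOf_tot Z Nat.succ Computable.succ⟩
  | left => exact ⟨_, useOf_tot Z _ (Computable.fst.comp Computable.unpair)⟩
  | right => exact ⟨_, useOf_tot Z _ (Computable.snd.comp Computable.unpair)⟩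
  | @pair f g _ _ ihf ihg =>
    obtain ⟨φ, hφ, hφm, hφc⟩ := ihf
    obtain ⟨ψ, hψ, hψm, hψc⟩ := ihg
    refine ⟨fun τ x => (φ τ x).bind fun a => (ψ τ x).map fun b => Nat.pair a b, ?_, ?_, ?_⟩
    · refine Computable.option_bind hφ (Computable.option_map (hψ.comp (Computable.fst.comp
        Computable.fst) (Computable.snd.comp Computable.fst)) ?_)
      exact comp_pair (Computable.snd.comp Computable.fst) Computable.snd
    · intro τ τ' x v hp h
      simp only [Option.bind_eq_some_iff, Option.map_eq_some_iff] at h ⊢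
      obtain ⟨a, ha, b, hb, rfl⟩ := h
      exact ⟨a, hφm _ _ _ _ hp ha, b, hψm _ _ _ _ hp hb, rfl⟩
    · intro x v h
      simp [Seq.seq] at h
      obtain ⟨a, ha, b, hb, rfl⟩ := h
      obtain ⟨m, hm⟩ := hφc _ _ ha
      obtain ⟨m', hm'⟩ := hψc _ _ hb
      refine ⟨max m m', fun n hn => ?_⟩
      simp [hm n (le_trans (le_max_left _ _) hn), hm' n (le_trans (le_max_right _ _) hn)]
  | @comp f g _ _ ihf ihg =>
    obtain ⟨φ, hφ, hφm, hφc⟩ := ihf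
    obtain ⟨ψ, hψ, hψm, hψc⟩ := ihg
    refine ⟨fun τ x => (ψ τ x).bind fun a => φ τ a, ?_, ?_, ?_⟩
    · exact Computable.option_bind hψ (hφ.comp (Computable.fst.comp Computable.fst)
        Computable.snd)
    · intro τ τ' x v hp h
      simp only [Option.bind_eq_some_iff] at h ⊢
      obtain ⟨a, ha, hb⟩ := h
      exact ⟨a, hψm _ _ _ _ hp ha, hφm _ _ _ _ hp hb⟩
    · intro x v h
      obtain ⟨a, ha, hb⟩ := Part.mem_bind_iff.1 h
      obtain ⟨m, hm⟩ := hφc _ _ hb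
      obtain ⟨m', hm'⟩ := hψc _ _ ha
      refine ⟨max m m', fun n hn => ?_⟩
      simp [hm n (le_trans (le_max_left _ _) hn), hm' n (le_trans (le_max_right _ _) hn)]
  | @prec f g _ _ ihf ihg =>
    obtain ⟨φ, hφ, hφm, hφc⟩ := ihf
    obtain ⟨ψ, hψ, hψm, hψc⟩ := ihg
    refine ⟨fun τ p => Nat.rec (φ τ p.unpair.1) (fun y IH => IH.bind fun i =>
      ψ τ (Nat.pair p.unpair.1 (Nat.pair y i))) p.unpair.2, ?_, ?_, ?_⟩
    · have h1 : Computable fun q : List Bool × ℕ => q.2.unpair.1 :=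
        Computable.fst.comp (Computable.unpair.comp Computable.snd)
      have h2 : Computable fun q : List Bool × ℕ => q.2.unpair.2 :=
        Computable.snd.comp (Computable.unpair.comp Computable.snd)
      refine Computable.nat_rec (f := fun q : List Bool × ℕ => q.2.unpair.2)
        (h := fun (q : List Bool × ℕ) (r : ℕ × Option ℕ) => r.2.bind fun i =>
          ψ q.1 (Nat.pair q.2.unpair.1 (Nat.pair r.1 i))) h2
        (hφ.comp Computable.fst h1) ?_
      refine Computable.option_bind (Computable.snd.comp Computable.snd) ?_
      refine hψ.comp (Computable.fst.comp (Computable.fst.comp Computable.fst)) ?_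
      exact comp_pair (h1.comp (Computable.fst.comp Computable.fst))
        (comp_pair (Computable.fst.comp (Computable.snd.comp Computable.fst)) Computable.snd)
    · intro τ τ' p v hp
      dsimp only
      generalize p.unpair.2 = n
      induction n generalizing v with
      | zero => exact hφm _ _ _ _ hp
      | succ n ih =>
        intro h
        simp only [Option.bind_eq_some_iff] at h ⊢
        obtain ⟨a, ha, hb⟩ := h
        exact ⟨a, ih _ ha, hψm _ _ _ _ hp hb⟩
    · intro p v
      simp only [Nat.unpaired]
      generalize p.unpair.2 = n
      induction n generalizing v with
      | zero => exact hφc _ _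
      | succ n ih =>
        intro h
        simp only [Part.bind_eq_bind, Part.mem_bind_iff] at h
        obtain ⟨a, ha, hb⟩ := h
        obtain ⟨m, hm⟩ := ih _ ha
        obtain ⟨m', hm'⟩ := hψc _ _ hb
        refine ⟨max m m', fun n hn => ?_⟩
        simp only [Option.bind_eq_some_iff]
        exact ⟨a, hm n (le_trans (le_max_left _ _) hn), hm' n (le_trans (le_max_right _ _) hn)⟩
  | @rfind f _ ihf =>
    obtain ⟨φ, hφ, hφm, hφc⟩ := ihf
    let p : List Bool × ℕ → ℕ → Bool := fun q n => decide (q.1.length ≤ n) ||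
      !(decide (1 ≤ (φ q.1 (Nat.pair q.2 n)).getD 0))
    have hval : Computable₂ (fun (q : List Bool × ℕ) (n : ℕ) => φ q.1 (Nat.pair q.2 n)) :=
      hφ.comp (Computable.fst.comp Computable.fst)
        (comp_pair (Computable.snd.comp Computable.fst) Computable.snd)
    have hpc : Computable₂ p :=
      comp_or (comp_le (Computable.list_length.comp (Computable.fst.comp Computable.fst))
        Computable.snd) (comp_not (comp_le (Computable.const 1)
          (Computable.option_getD hval (Computable.const 0))))
    have hex : ∀ q, ∃ n, p q n = true := fun q => ⟨q.1.length, by simp [p]⟩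
    let F : List Bool × ℕ → ℕ := fun q => Nat.find (hex q)
    have hF : Computable F := comp_find hpc hex
    have char : ∀ τ a n, n ≤ τ.length → φ τ (Nat.pair a n) = some 0 →
        (∀ j < n, ∃ k, φ τ (Nat.pair a j) = some (k + 1)) → F (τ, a) = n := by
      intro τ a n hn h0 hj
      refine (Nat.find_eq_iff _).2 ⟨?_, ?_⟩
      · simp [p, h0]
      · intro j hjn
        obtain ⟨k, hk⟩ := hj j hjn
        simp [p, hk]
        omega
    refine ⟨fun τ a => bif decide (φ τ (Nat.pair a (F (τ, a))) = some 0) then some (F (τ, a))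
      else none, ?_, ?_, ?_⟩
    · exact Computable.cond (comp_eq (hval.comp Computable.id hF) (Computable.const _))
        (Computable.option_some.comp hF) (Computable.const _)
    · intro τ τ' a v hp h
      rcases hc : decide (φ τ (Nat.pair a (F (τ, a))) = some 0) with _ | _
      · simp [hc] at h
      · simp only [hc, cond_true, Option.some.injEq] at h
        rw [h, decide_eq_true_eq] at hc
        have hle : v ≤ τ.length := by
          rw [← h]
          exact Nat.find_min' _ (by simp [p])
        have hj : ∀ j < v, ∃ k, φ τ (Nat.pair a j) = some (k + 1) := by
          intro j hj
          rw [← h] at hj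
          have := Nat.find_min (hex (τ, a)) hj
          simp only [p, Bool.or_eq_true, not_or, Bool.not_eq_true', decide_eq_true_eq,
            decide_eq_false_iff_not, not_not] at this
          rcases hh : φ τ (Nat.pair a j) with _ | k
          · simp [hh] at this
          · rcases k with _ | k
            · simp [hh] at this
            · exact ⟨k, rfl⟩
        have h0' := hφm _ _ _ _ hp hc
        have : F (τ', a) = v := char _ _ _ (hle.trans hp.length_le) h0' (fun j hjv => by
          obtain ⟨k, hk⟩ := hj j hjv
          exact ⟨k, hφm _ _ _ _ hp hk⟩)
        dsimp only
        rw [this, h0']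
        simp
    · intro a v h
      obtain ⟨h1, h2⟩ := Nat.mem_rfind.1 h
      have h0 : (0 : ℕ) ∈ f (Nat.pair a v) := by simpa using h1
      have hs : ∀ j < v, ∃ k, (k + 1) ∈ f (Nat.pair a j) := by
        intro j hj
        have := h2 hj
        simp at this
        obtain ⟨k, hk, hk0⟩ := this
        obtain ⟨k', rfl⟩ := Nat.exists_eq_succ_of_ne_zero hk0
        exact ⟨k', hk⟩
      obtain ⟨m0, hm0⟩ := hφc _ _ h0
      have hs' : ∀ N ≤ v, ∃ m, ∀ n, m ≤ n → ∀ j < N, ∃ k,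
          φ (restr Z n) (Nat.pair a j) = some (k + 1) := by
        intro N
        induction N with
        | zero => exact fun _ => ⟨0, fun _ _ j hj => absurd hj (Nat.not_lt_zero j)⟩
        | succ N ih =>
          intro hN
          obtain ⟨m, hm⟩ := ih (by omega)
          obtain ⟨k, hk⟩ := hs N (by omega)
          obtain ⟨m', hm'⟩ := hφc _ _ hk
          refine ⟨max m m', fun n hn j hj => ?_⟩
          rcases Nat.lt_succ_iff_lt_or_eq.1 hj with hj | rfl
          · exact hm n (le_trans (le_max_left _ _) hn) j hj
          · exact ⟨k, hm' n (le_trans (le_max_right _ _) hn)⟩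
      obtain ⟨m1, hm1⟩ := hs' v le_rfl
      refine ⟨max (max m0 m1) v, fun n hn => ?_⟩
      have e0 := hm0 n (by omega)
      have : F (restr Z n, a) = v := char _ _ _ (by rw [restr_length]; omega) e0
        (hm1 n (by omega))
      dsimp only
      rw [this, e0]
      simp


/-! ### Counting -/

/-- number of `k < 2^s` satisfying `p`. -/
def cnt (p : ℕ → Bool) (s : ℕ) : ℕ := Nat.count (fun k => p k = true) (2 ^ s)

theorem cnt_eq_card (p : ℕ → Bool) (s : ℕ) :
    cnt p s = ((Finset.range (2 ^ s)).filter (fun k => p k = true)).card :=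
  Nat.count_eq_card_filter_range _ _

theorem cnt_mono {p q : ℕ → Bool} {s : ℕ} (h : ∀ k < 2 ^ s, p k = true → q k = true) :
    cnt p s ≤ cnt q s := by
  rw [cnt_eq_card, cnt_eq_card]
  refine Finset.card_le_card fun k hk => ?_
  simp only [Finset.mem_filter, Finset.mem_range] at hk ⊢
  exact ⟨hk.1, h k hk.1 hk.2⟩

theorem cnt_union {p q r : ℕ → Bool} {s : ℕ}
    (h : ∀ k < 2 ^ s, p k = true → q k = true ∨ r k = true) :
    cnt p s ≤ cnt q s + cnt r s := by
  rw [cnt_eq_card, cnt_eq_card, cnt_eq_card]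
  refine le_trans (Finset.card_le_card fun k hk => ?_) (Finset.card_union_le _ _)
  simp only [Finset.mem_filter, Finset.mem_range, Finset.mem_union] at hk ⊢
  rcases h k hk.1 hk.2 with h | h
  · exact Or.inl ⟨hk.1, h⟩
  · exact Or.inr ⟨hk.1, h⟩

theorem cnt_double (p : ℕ → Bool) (s : ℕ) :
    cnt (fun k => p (k % 2 ^ s)) (s + 1) = 2 * cnt p s := by
  have e : 2 ^ (s + 1) = 2 ^ s + 2 ^ s := by ring
  unfold cnt
  rw [e, Nat.count_add, two_mul, Nat.count_eq_card_filter_range, Nat.count_eq_card_filter_range,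
    Nat.count_eq_card_filter_range]
  congr 2
  · refine Finset.filter_congr fun k hk => ?_
    dsimp only
    rw [Nat.mod_eq_of_lt (Finset.mem_range.1 hk)]
  · refine Finset.filter_congr fun k hk => ?_
    dsimp only
    rw [Nat.add_mod_left, Nat.mod_eq_of_lt (Finset.mem_range.1 hk)]

theorem cnt_pull (p : ℕ → Bool) (u : ℕ) {s : ℕ} (h : u ≤ s) :
    cnt (fun k => p (k % 2 ^ u)) s = 2 ^ (s - u) * cnt p u := by
  induction s, h using Nat.le_induction with
  | base =>
    simp only [Nat.sub_self, pow_zero, one_mul]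
    refine le_antisymm (cnt_mono fun k hk h => ?_) (cnt_mono fun k hk h => ?_)
    · rwa [Nat.mod_eq_of_lt hk] at h
    · rwa [Nat.mod_eq_of_lt hk]
  | succ s hs ih =>
    have := cnt_double (fun k => p (k % 2 ^ u)) s
    simp only [Nat.mod_mod_of_dvd _ (pow_dvd_pow 2 hs)] at this
    rw [this, ih, Nat.sub_add_comm hs, pow_succ]
    ring

theorem comp3 {α β : Type} [Primcodable α] [Primcodable β] (H : ℕ → ℕ → ℕ → β)
    (hH : Computable fun q : ℕ × ℕ × ℕ => H q.1 q.2.1 q.2.2) (f g h : α → ℕ)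
    (hf : Computable f) (hg : Computable g) (hh : Computable h) :
    Computable fun a => H (f a) (g a) (h a) :=
  Computable.comp (f := fun q : ℕ × ℕ × ℕ => H q.1 q.2.1 q.2.2)
    (g := fun a => (f a, g a, h a)) hH (Computable.pair hf (Computable.pair hg hh))

/-! ### The construction -/

section construction
variable (T : ℕ → ℕ → Bool) (G : ℕ → ℕ → ℕ → Bool) (d : ℕ)

def lowB (n s : ℕ) : Bool := decide (cnt (G n s) s * 2 ^ (2 * n + d + 1) ≤ 2 ^ s)

def Qs : ℕ → ℕ → ℕ → Bool
  | 0, s, k => T s k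
  | n + 1, s, k => Qs n s k && !(lowB G d n s && G n s k)

def leftB (n s u : ℕ) : Bool :=
  decide (2 ^ s ≤ cnt (fun k => Qs T G d (n + 1) s k && decide (k % 2 ^ (n + 1) = u)) s *
      2 ^ (2 * n + d + 2))

def sg : ℕ → ℕ → ℕ
  | 0, _ => 0
  | n + 1, s => bif leftB T G d n s (sg n s) then sg n s else sg n s + 2 ^ n

variable {T G d}

theorem Qs_iff (n s k : ℕ) : Qs T G d n s k = true ↔
    T s k = true ∧ ∀ n' < n, cnt (G n' s) s * 2 ^ (2 * n' + d + 1) ≤ 2 ^ s → G n' s k = false := by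
  induction n with
  | zero => simp [Qs]
  | succ n ih =>
    simp only [Qs, Bool.and_eq_true, ih, Nat.forall_lt_succ_right, and_assoc, lowB]
    refine and_congr_right fun _ => and_congr_right fun _ => ?_
    by_cases h : cnt (G n s) s * 2 ^ (2 * n + d + 1) ≤ 2 ^ s <;> simp [h]

theorem comp_cnt {α : Type*} [Primcodable α] {p : α → ℕ → Bool} (hp : Computable₂ p)
    {N : α → ℕ} (hN : Computable N) : Computable fun a => cnt (p a) (N a) :=
  comp_count hp (comp_pow (Computable.const 2) hN)

theorem comp_lowB (hG : Computable fun q : ℕ × ℕ × ℕ => G q.1 q.2.1 q.2.2) :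
    Computable₂ (lowB G d) := by
  have h1 : Computable fun w : (ℕ × ℕ) × ℕ => G w.1.1 w.1.2 w.2 :=
    comp3 G hG _ _ _
      (Computable.fst.comp Computable.fst) (Computable.snd.comp Computable.fst) Computable.snd
  have h2 : Computable fun q : ℕ × ℕ => cnt (G q.1 q.2) q.2 :=
    comp_cnt (p := fun (q : ℕ × ℕ) (k : ℕ) => G q.1 q.2 k) (N := fun q => q.2) h1 Computable.snd
  have h3 : Computable fun q : ℕ × ℕ => 2 ^ (2 * q.1 + d + 1) :=
    comp_pow (Computable.const 2)
      (comp_add (comp_add (comp_mul (Computable.const 2) Computable.fst) (Computable.const d))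
      (Computable.const 1))
  have h4 : Computable fun q : ℕ × ℕ => 2 ^ q.2 :=
    comp_pow (Computable.const 2) Computable.snd
  exact comp_le (comp_mul h2 h3) h4

theorem comp_Qs (hT : Computable₂ T) (hG : Computable fun q : ℕ × ℕ × ℕ => G q.1 q.2.1 q.2.2) :
    Computable fun q : ℕ × ℕ × ℕ => Qs T G d q.1 q.2.1 q.2.2 := by
  have a1 : Computable fun w : (ℕ × ℕ × ℕ) × (ℕ × Bool) => w.2.1 :=
    Computable.fst.comp Computable.snd
  have a2 : Computable fun w : (ℕ × ℕ × ℕ) × (ℕ × Bool) => w.1.2 :=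
    Computable.snd.comp Computable.fst
  have a3 : Computable fun w : (ℕ × ℕ × ℕ) × (ℕ × Bool) => w.1.2.1 := Computable.fst.comp a2
  have a4 : Computable fun w : (ℕ × ℕ × ℕ) × (ℕ × Bool) => w.1.2.2 := Computable.snd.comp a2
  have a5 : Computable fun w : (ℕ × ℕ × ℕ) × (ℕ × Bool) => w.2.2 :=
    Computable.snd.comp Computable.snd
  have b1 : Computable fun w : (ℕ × ℕ × ℕ) × (ℕ × Bool) => lowB G d w.2.1 w.1.2.1 :=
    (comp_lowB hG).comp a1 a3
  have b2 : Computable fun w : (ℕ × ℕ × ℕ) × (ℕ × Bool) => G w.2.1 w.1.2.1 w.1.2.2 :=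
    comp3 G hG _ _ _ a1 a3 a4
  have hh : Computable₂ (fun (q : ℕ × ℕ × ℕ) (r : ℕ × Bool) =>
      r.2 && !(lowB G d r.1 q.2.1 && G r.1 q.2.1 q.2.2)) := comp_and a5 (comp_not (comp_and b1 b2))
  have h0 : Computable fun q : ℕ × ℕ × ℕ => T q.2.1 q.2.2 :=
    hT.comp (Computable.fst.comp Computable.snd) (Computable.snd.comp Computable.snd)
  refine (Computable.nat_rec (f := fun q : ℕ × ℕ × ℕ => q.1) Computable.fst h0
    hh).of_eq fun q => ?_
  obtain ⟨n, s, k⟩ := q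
  induction n with
  | zero => rfl
  | succ n ih =>
    dsimp only at ih ⊢
    simp only [Qs, ← ih]

theorem comp_sg (hT : Computable₂ T) (hG : Computable fun q : ℕ × ℕ × ℕ => G q.1 q.2.1 q.2.2) :
    Computable₂ (sg T G d) := by
  have hl : Computable fun q : ℕ × ℕ × ℕ => leftB T G d q.1 q.2.1 q.2.2 := by
    have a1 : Computable fun q : ℕ × ℕ × ℕ => q.1 := Computable.fst
    have a2 : Computable fun q : ℕ × ℕ × ℕ => q.2.1 := Computable.fst.comp Computable.snd
    have a3 : Computable fun q : ℕ × ℕ × ℕ => q.2.2 := Computable.snd.comp Computable.snd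
    have b1 : Computable fun w : (ℕ × ℕ × ℕ) × ℕ => w.1.1 + 1 :=
      comp_add (a1.comp Computable.fst) (Computable.const 1)
    have b2 : Computable fun w : (ℕ × ℕ × ℕ) × ℕ => w.1.2.1 := a2.comp Computable.fst
    have b3 : Computable fun w : (ℕ × ℕ × ℕ) × ℕ => w.1.2.2 := a3.comp Computable.fst
    have b4 : Computable fun w : (ℕ × ℕ × ℕ) × ℕ => Qs T G d (w.1.1 + 1) w.1.2.1 w.2 :=
      comp3 (Qs T G d) (comp_Qs hT hG) _ _ _ b1 b2 Computable.snd
    have b5 : Computable fun w : (ℕ × ℕ × ℕ) × ℕ => w.2 % 2 ^ (w.1.1 + 1) :=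
      comp_mod Computable.snd (comp_pow (Computable.const 2) b1)
    have h1 : Computable₂ (fun (q : ℕ × ℕ × ℕ) (k : ℕ) =>
        Qs T G d (q.1 + 1) q.2.1 k && decide (k % 2 ^ (q.1 + 1) = q.2.2)) :=
      comp_and b4 (comp_eq b5 b3)
    have h2 := comp_cnt h1 a2
    have h3 : Computable fun q : ℕ × ℕ × ℕ => 2 ^ (2 * q.1 + d + 2) :=
      comp_pow (Computable.const 2) (comp_add (comp_add (comp_mul (Computable.const 2) a1)
        (Computable.const d)) (Computable.const 2))
    have h4 : Computable fun q : ℕ × ℕ × ℕ => 2 ^ q.2.1 :=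
      comp_pow (Computable.const 2) a2
    exact comp_le h4 (comp_mul h2 h3)
  have hh : Computable₂ (fun (q : ℕ × ℕ) (r : ℕ × ℕ) =>
      bif leftB T G d r.1 q.2 r.2 then r.2 else r.2 + 2 ^ r.1) := by
    have c1 : Computable fun w : (ℕ × ℕ) × (ℕ × ℕ) => w.2.1 := Computable.fst.comp Computable.snd
    have c2 : Computable fun w : (ℕ × ℕ) × (ℕ × ℕ) => w.2.2 := Computable.snd.comp Computable.snd
    have c3 : Computable fun w : (ℕ × ℕ) × (ℕ × ℕ) => w.1.2 := Computable.snd.comp Computable.fst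
    have c4 : Computable fun w : (ℕ × ℕ) × (ℕ × ℕ) => leftB T G d w.2.1 w.1.2 w.2.2 :=
      comp3 (leftB T G d) hl _ _ _ c1 c3 c2
    have c5 : Computable fun w : (ℕ × ℕ) × (ℕ × ℕ) => w.2.2 + 2 ^ w.2.1 :=
      comp_add c2 (comp_pow (Computable.const 2) c1)
    exact Computable.cond c4 c2 c5
  refine (Computable.nat_rec (f := fun q : ℕ × ℕ => q.1) Computable.fst
    (Computable.const 0) hh).of_eq fun q => ?_
  obtain ⟨n, s⟩ := q
  induction n with
  | zero => rfl
  | succ n ih =>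
    dsimp only at ih ⊢
    simp only [sg, ← ih]

theorem low_stable (n : ℕ)
    (hGm : ∃ t, ∀ s, t ≤ s → ∀ k, G n s (k % 2 ^ s) = true → G n (s + 1) k = true) :
    ∃ t b, ∀ s, t ≤ s → lowB G d n s = b := by
  obtain ⟨t, ht⟩ := hGm
  have step : ∀ s, t ≤ s → lowB G d n s = false → lowB G d n (s + 1) = false := by
    intro s hs h
    have h2 : 2 * cnt (G n s) s ≤ cnt (G n (s + 1)) (s + 1) := by
      rw [← cnt_double]
      exact cnt_mono fun k _ h => ht s hs k h
    simp only [lowB, decide_eq_false_iff_not, not_le] at h ⊢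
    have := Nat.mul_le_mul_right (2 ^ (2 * n + d + 1)) h2
    rw [pow_succ 2 s]
    nlinarith
  by_cases h : ∃ s, t ≤ s ∧ lowB G d n s = false
  · obtain ⟨s, hs, h⟩ := h
    refine ⟨s, false, fun s' hs' => ?_⟩
    induction s', hs' using Nat.le_induction with
    | base => exact h
    | succ s' hs' ih => exact step s' (hs.trans hs') ih
  · push Not at h
    exact ⟨t, true, fun s hs => by simpa using h s hs⟩

theorem Qs_decr (hTm : ∀ s k, T (s + 1) k = true → T s (k % 2 ^ s) = true)
    (hGm : ∀ n, ∃ t, ∀ s, t ≤ s → ∀ k, G n s (k % 2 ^ s) = true → G n (s + 1) k = true) (n : ℕ) :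
    ∃ t, ∀ s, t ≤ s → ∀ k, Qs T G d n (s + 1) k = true → Qs T G d n s (k % 2 ^ s) = true := by
  induction n with
  | zero => exact ⟨0, fun s _ k h => hTm s k h⟩
  | succ n ih =>
    obtain ⟨t1, h1⟩ := ih
    obtain ⟨t2, b, h2⟩ := low_stable (d := d) n (hGm n)
    obtain ⟨t3, h3⟩ := hGm n
    refine ⟨max t1 (max t2 t3), fun s hs k h => ?_⟩
    simp only [Qs, Bool.and_eq_true] at h ⊢
    refine ⟨h1 s (by omega) k h.1, ?_⟩
    have h' := h.2
    rw [h2 (s + 1) (by omega)] at h'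
    rw [h2 s (by omega)]
    cases b with
    | false => rfl
    | true =>
      simp only [Bool.true_and, Bool.not_eq_true'] at h' ⊢
      by_contra hc
      have := h3 s (by omega) k (by simpa using hc)
      rw [this] at h'
      exact absurd h' (by simp)

theorem sg_stable (hTm : ∀ s k, T (s + 1) k = true → T s (k % 2 ^ s) = true)
    (hGm : ∀ n, ∃ t, ∀ s, t ≤ s → ∀ k, G n s (k % 2 ^ s) = true → G n (s + 1) k = true)
    (hd : ∀ s, 2 ^ s ≤ cnt (T s) s * 2 ^ d) (n : ℕ) :
    ∃ u t, u < 2 ^ n ∧ ∀ s, t ≤ s → sg T G d n s = u ∧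
      2 ^ s ≤ cnt (fun k => Qs T G d n s k && decide (k % 2 ^ n = u)) s * 2 ^ (2 * n + d) := by
  induction n with
  | zero =>
    refine ⟨0, 0, by simp, fun s _ => ⟨rfl, ?_⟩⟩
    simpa [Qs, Nat.mod_one] using hd s
  | succ n ih =>
    obtain ⟨u, t, hu, ht⟩ := ih
    obtain ⟨t1, h1⟩ := Qs_decr (d := d) hTm hGm (n + 1)
    have split : ∀ s, t ≤ s →
        2 ^ s ≤ cnt (fun k => Qs T G d (n + 1) s k && decide (k % 2 ^ (n + 1) = u)) s *
          2 ^ (2 * n + d + 2) ∨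
        2 ^ s ≤ cnt (fun k => Qs T G d (n + 1) s k && decide (k % 2 ^ (n + 1) = u + 2 ^ n)) s *
          2 ^ (2 * n + d + 2) := by
      intro s hs
      have hx := (ht s hs).2
      have hz : cnt (fun k => lowB G d n s && G n s k) s * 2 ^ (2 * n + d + 1) ≤ 2 ^ s := by
        cases hl : lowB G d n s with
        | false => simp [cnt, Nat.count_eq_card_filter_range]
        | true =>
          simp only [lowB, decide_eq_true_eq] at hl
          simpa using hl
      have hxy : cnt (fun k => Qs T G d n s k && decide (k % 2 ^ n = u)) s ≤
          cnt (fun k => Qs T G d (n + 1) s k && decide (k % 2 ^ n = u)) s +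
          cnt (fun k => lowB G d n s && G n s k) s := by
        refine cnt_union fun k _ h => ?_
        simp only [Qs, Bool.and_eq_true] at h ⊢
        by_cases hc : (lowB G d n s && G n s k) = true
        · exact Or.inr (by simpa using hc)
        · exact Or.inl ⟨⟨h.1, by rw [Bool.eq_false_iff.2 hc]; rfl⟩, h.2⟩
      have hlr : cnt (fun k => Qs T G d (n + 1) s k && decide (k % 2 ^ n = u)) s ≤
          cnt (fun k => Qs T G d (n + 1) s k && decide (k % 2 ^ (n + 1) = u)) s +
          cnt (fun k => Qs T G d (n + 1) s k && decide (k % 2 ^ (n + 1) = u + 2 ^ n)) s := by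
        refine cnt_union fun k _ h => ?_
        simp only [Bool.and_eq_true, decide_eq_true_eq] at h ⊢
        have e : k % 2 ^ (n + 1) = k % 2 ^ n + 2 ^ n * (k / 2 ^ n % 2) := by
          rw [pow_succ, Nat.mod_mul]
        rw [e, h.2]
        rcases Nat.mod_two_eq_zero_or_one (k / 2 ^ n) with h0 | h0 <;> rw [h0]
        · exact Or.inl ⟨h.1, by simp⟩
        · exact Or.inr ⟨h.1, by simp⟩
      by_contra hcon
      push Not at hcon
      obtain ⟨c1, c2⟩ := hcon
      generalize cnt (fun k => Qs T G d (n + 1) s k && decide (k % 2 ^ (n + 1) = u)) s = l at *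
      generalize cnt (fun k => Qs T G d (n + 1) s k && decide (k % 2 ^ (n + 1) = u + 2 ^ n)) s = r
        at *
      generalize cnt (fun k => Qs T G d (n + 1) s k && decide (k % 2 ^ n = u)) s = y at *
      generalize cnt (fun k => Qs T G d n s k && decide (k % 2 ^ n = u)) s = x at *
      generalize cnt (fun k => lowB G d n s && G n s k) s = z at *
      rw [pow_succ] at hz
      rw [show 2 * n + d + 2 = (2 * n + d) + 1 + 1 by ring, pow_succ, pow_succ] at c1 c2
      generalize 2 ^ (2 * n + d) = D at *
      have : x * D ≤ (l + r + z) * D := Nat.mul_le_mul_right _ (by omega)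
      nlinarith
    have leftstep : ∀ s, max t1 (n + 1) ≤ s → leftB T G d n s u = false →
        leftB T G d n (s + 1) u = false := by
      intro s hs h
      have h2 : cnt (fun k => Qs T G d (n + 1) (s + 1) k && decide (k % 2 ^ (n + 1) = u)) (s + 1)
          ≤ 2 * cnt (fun k => Qs T G d (n + 1) s k && decide (k % 2 ^ (n + 1) = u)) s := by
        rw [← cnt_double]
        refine cnt_mono fun k _ h => ?_
        simp only [Bool.and_eq_true, decide_eq_true_eq] at h ⊢
        refine ⟨h1 s (by omega) k h.1, ?_⟩
        rw [Nat.mod_mod_of_dvd _ (pow_dvd_pow 2 (by omega)), h.2]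
      simp only [leftB, decide_eq_false_iff_not, not_le] at h ⊢
      have := Nat.mul_le_mul_right (2 ^ (2 * n + d + 2)) h2
      rw [pow_succ 2 s]
      nlinarith
    have e2 : 2 * (n + 1) + d = 2 * n + d + 2 := by ring
    by_cases hl : ∃ s, max t (max t1 (n + 1)) ≤ s ∧ leftB T G d n s u = false
    · obtain ⟨s0, hs0, hl⟩ := hl
      refine ⟨u + 2 ^ n, s0, by rw [pow_succ]; omega, fun s hs => ?_⟩
      have hlf : leftB T G d n s u = false := by
        induction s, hs using Nat.le_induction with
        | base => exact hl
        | succ s' hs' ih => exact leftstep s' (by omega) ih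
      refine ⟨?_, ?_⟩
      · simp only [sg, (ht s (by omega)).1, hlf, cond_false]
      · rw [e2]
        refine (split s (by omega)).resolve_left ?_
        simpa [leftB] using hlf
    · push Not at hl
      refine ⟨u, max t (max t1 (n + 1)), by rw [pow_succ]; omega, fun s hs => ?_⟩
      have hlt : leftB T G d n s u = true := by simpa using hl s hs
      refine ⟨?_, ?_⟩
      · simp only [sg, (ht s (by omega)).1, hlt, cond_true]
      · rw [e2]
        simpa [leftB] using hlt

end construction

theorem forcing (T : ℕ → ℕ → Bool) (G : ℕ → ℕ → ℕ → Bool) (d : ℕ) (hT : Computable₂ T)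
    (hG : Computable fun q : ℕ × ℕ × ℕ => G q.1 q.2.1 q.2.2)
    (hTm : ∀ s k, T (s + 1) k = true → T s (k % 2 ^ s) = true)
    (hGm : ∀ n, ∃ t, ∀ s, t ≤ s → ∀ k, G n s (k % 2 ^ s) = true → G n (s + 1) k = true)
    (hd : ∀ s, 2 ^ s ≤ cnt (T s) s * 2 ^ d) :
    ∃ Z, Delta02 Z ∧ ∀ m, ∃ t, ∀ s, t ≤ s → ∃ k, T s k = true ∧
      restr k.testBit m = restr Z m ∧
      ∀ n < m, cnt (G n s) s * 2 ^ (2 * n + d + 1) ≤ 2 ^ s → G n s k = false := by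
  choose u t hu ht using sg_stable hTm hGm hd
  have coh1 : ∀ n, u (n + 1) % 2 ^ n = u n := by
    intro n
    have a := (ht n (max (t n) (t (n + 1))) (le_max_left _ _)).1
    have b := (ht (n + 1) (max (t n) (t (n + 1))) (le_max_right _ _)).1
    rw [← b, sg, a]
    cases leftB T G d n (max (t n) (t (n + 1))) (u n) <;> simp [Nat.mod_eq_of_lt (hu n)]
  have coh : ∀ n m, n ≤ m → u m % 2 ^ n = u n := by
    intro n m h
    induction m, h using Nat.le_induction with
    | base => exact Nat.mod_eq_of_lt (hu n)
    | succ m hm ih =>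
      rw [← ih, ← coh1 m, Nat.mod_mod_of_dvd _ (pow_dvd_pow 2 hm)]
  refine ⟨fun x => (u (x + 1)).testBit x, ⟨fun s x => (sg T G d (x + 1) s).testBit x, ?_, ?_⟩, ?_⟩
  · exact comp_testBit ((comp_sg hT hG).comp (comp_add Computable.snd (Computable.const 1))
      Computable.fst) Computable.snd
  · intro x
    refine ⟨t (x + 1), fun s hs => ?_⟩
    dsimp only
    rw [(ht (x + 1) s hs).1]
  · intro m
    refine ⟨t m, fun s hs => ?_⟩
    have hc := (ht m s hs).2
    have hpos : 0 < cnt (fun k => Qs T G d m s k && decide (k % 2 ^ m = u m)) s := by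
      rcases Nat.eq_zero_or_pos (cnt (fun k => Qs T G d m s k && decide (k % 2 ^ m = u m)) s)
        with h0 | h0
      · rw [h0, zero_mul] at hc
        exact absurd hc (by simp)
      · exact h0
    rw [cnt_eq_card, Finset.card_pos] at hpos
    obtain ⟨k, hk⟩ := hpos
    simp only [Finset.mem_filter, Bool.and_eq_true, decide_eq_true_eq, Qs_iff] at hk
    refine ⟨k, hk.2.1.1, ?_, hk.2.1.2⟩
    unfold restr
    refine List.map_congr_left fun x hx => ?_
    have hx : x < m := List.mem_range.1 hx
    rw [← coh (x + 1) m hx, ← hk.2.2, Nat.mod_mod_of_dvd _ (pow_dvd_pow 2 hx),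
      Nat.testBit_mod_two_pow]
    simp


/-! ### Positive measure -/

theorem restr_mod (k : ℕ) {m s : ℕ} (h : m ≤ s) :
    restr (k % 2 ^ s).testBit m = restr k.testBit m := by
  unfold restr
  refine List.map_congr_left fun x hx => ?_
  have hx : x < m := List.mem_range.1 hx
  rw [Nat.testBit_mod_two_pow]
  simp [show x < s by omega]

/-- the stage-`s` approximation (from above) to the class given by `f`. -/
def TT (f : ℕ → Option (List Bool)) (s k : ℕ) : Bool :=
  decide (∀ i < s, ((f i).map fun ρ =>
    !(decide (ρ.length ≤ s) && decide (ρ = restr k.testBit ρ.length))).getD true = true)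

theorem TT_iff (f : ℕ → Option (List Bool)) (s k : ℕ) : TT f s k = true ↔
    ∀ i < s, ∀ ρ, f i = some ρ → ρ.length ≤ s → ρ ≠ restr k.testBit ρ.length := by
  simp only [TT, decide_eq_true_eq]
  refine forall_congr' fun i => forall_congr' fun _ => ?_
  cases h : f i with
  | none => simp
  | some ρ =>
    by_cases h1 : ρ.length ≤ s <;> by_cases h2 : ρ = restr k.testBit ρ.length
    all_goals simp only [Option.map_some, Option.getD_some, Option.some.injEq, forall_eq']
    · simp [h1, ← h2]
    · simp [h1, h2]
    · simp [h1]
    · simp [h1]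

theorem comp_testBit2 : Computable₂ fun k x : ℕ => k.testBit x :=
  comp_testBit Computable.fst Computable.snd

theorem comp_restr_bits {α : Type*} [Primcodable α] {k N : α → ℕ} (hk : Computable k)
    (hN : Computable N) : Computable fun a => restr (k a).testBit (N a) :=
  comp_restr (Z := fun a => (k a).testBit)
    (comp_testBit (hk.comp Computable.fst) Computable.snd) hN

theorem comp_TT (f : ℕ → Option (List Bool)) (hf : Computable f) : Computable₂ (TT f) := by
  have a1 : Computable fun w : ((ℕ × ℕ) × ℕ) × List Bool => w.2.length :=
    Computable.list_length.comp Computable.snd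
  have a2 : Computable fun w : ((ℕ × ℕ) × ℕ) × List Bool => w.1.1.1 :=
    Computable.fst.comp (Computable.fst.comp Computable.fst)
  have a3 : Computable fun w : ((ℕ × ℕ) × ℕ) × List Bool => w.1.1.2 :=
    Computable.snd.comp (Computable.fst.comp Computable.fst)
  have a4 : Computable fun w : ((ℕ × ℕ) × ℕ) × List Bool => restr w.1.1.2.testBit w.2.length :=
    comp_restr_bits a3 a1
  have a5 : Computable fun w : ((ℕ × ℕ) × ℕ) × List Bool =>
      !(decide (w.2.length ≤ w.1.1.1) && decide (w.2 = restr w.1.1.2.testBit w.2.length)) :=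
    comp_not (comp_and (comp_le a1 a2) (comp_eq Computable.snd a4))
  have a6 : Computable fun w : (ℕ × ℕ) × ℕ => f w.2 := hf.comp Computable.snd
  have a7 : Computable fun w : (ℕ × ℕ) × ℕ => ((f w.2).map fun ρ : List Bool =>
    !(decide (ρ.length ≤ w.1.1) && decide (ρ = restr w.1.2.testBit ρ.length))).getD true :=
    Computable.option_getD (Computable.option_map a6 a5) (Computable.const true)
  exact comp_ball (p := fun (w : ℕ × ℕ) (i : ℕ) => ((f i).map fun ρ : List Bool =>
    !(decide (ρ.length ≤ w.1) && decide (ρ = restr w.2.testBit ρ.length))).getD true)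
    (N := fun w => w.1) a7 Computable.fst

theorem TT_mono (f : ℕ → Option (List Bool)) (s k : ℕ) (h : TT f (s + 1) k = true) :
    TT f s (k % 2 ^ s) = true := by
  rw [TT_iff] at h ⊢
  intro i hi ρ hρ hl
  rw [restr_mod k hl]
  exact h i (by omega) ρ hρ (by omega)

theorem exists_bits (Z : ℕ → Bool) (s : ℕ) : ∃ k < 2 ^ s, ∀ m ≤ s,
    restr k.testBit m = restr Z m := by
  refine ⟨Nat.ofBits (fun i : Fin s => Z i), Nat.ofBits_lt_two_pow _, fun m hm => ?_⟩
  unfold restr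
  refine List.map_congr_left fun x hx => ?_
  have hx : x < m := List.mem_range.1 hx
  rw [Nat.testBit_ofBits_lt _ _ (by omega)]

theorem positive_measure (f : ℕ → Option (List Bool)) (hf : Computable f) (Z : ℕ → Bool)
    (hZ : ∀ i σ, f i = some σ → ¬ InitSeg σ Z) (hr : MLRandom Z) :
    ∃ d, ∀ s, 2 ^ s ≤ cnt (TT f s) s * 2 ^ d := by
  by_contra hcon
  push Not at hcon
  have hex : ∀ d, ∃ s, decide (cnt (TT f s) s * 2 ^ d < 2 ^ s) = true := by
    intro d
    obtain ⟨s, hs⟩ := hcon d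
    exact ⟨s, by simpa using hs⟩
  have hTc := comp_TT f hf
  have b1 : Computable fun s => cnt (TT f s) s := comp_cnt hTc Computable.id
  have hp : Computable₂ fun d s => decide (cnt (TT f s) s * 2 ^ d < 2 ^ s) :=
    comp_lt (comp_mul (b1.comp Computable.snd) (comp_pow (Computable.const 2) Computable.fst))
      (comp_pow (Computable.const 2) Computable.snd)
  have hS := comp_find hp hex
  have hSs : ∀ d, cnt (TT f (Nat.find (hex d))) (Nat.find (hex d)) * 2 ^ d
      < 2 ^ (Nat.find (hex d)) := fun d => by simpa using Nat.find_spec (hex d)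
  generalize hSd : (fun d => Nat.find (hex d)) = S at hS
  have hSs : ∀ d, cnt (TT f (S d)) (S d) * 2 ^ d < 2 ^ (S d) := by
    subst hSd; exact hSs
  let ok : ℕ → ℕ → Bool := fun d k => decide (k < 2 ^ S d) && TT f (S d) k
  let σ : ℕ → List Bool := fun j => bif ok j.unpair.1 j.unpair.2 then
    restr (j.unpair.2).testBit (S j.unpair.1) else restr (0 : ℕ).testBit j
  have u1 : Computable fun j : ℕ => j.unpair.1 := Computable.fst.comp Computable.unpair
  have u2 : Computable fun j : ℕ => j.unpair.2 := Computable.snd.comp Computable.unpair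
  have u3 : Computable fun j : ℕ => S j.unpair.1 := hS.comp u1
  have hok : Computable fun j : ℕ => ok j.unpair.1 j.unpair.2 :=
    comp_and (comp_lt u2 (comp_pow (Computable.const 2) u3)) (hTc.comp u3 u2)
  have hσ : Computable σ := Computable.cond hok (comp_restr_bits u2 u3)
    (comp_restr_bits (Computable.const 0) Computable.id)
  have hsum1 : Summable fun j : ℕ => if ok j.unpair.1 j.unpair.2 = true then
      ((1 : ℝ) / 2) ^ S j.unpair.1 else 0 := by
    have hinner : ∀ d, Summable fun k => if ok d k = true then ((1 : ℝ) / 2) ^ S d else 0 := by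
      intro d
      refine summable_of_ne_finset_zero (s := Finset.range (2 ^ S d)) fun k hk => ?_
      have : ok d k = false := by
        have : ¬ k < 2 ^ S d := by simpa using hk
        simp [ok, this]
      simp [this]
    have hval : ∀ d, ∑' k, (if ok d k = true then ((1 : ℝ) / 2) ^ S d else 0)
        = cnt (TT f (S d)) (S d) * (1 / 2) ^ S d := by
      intro d
      rw [tsum_eq_sum (s := Finset.range (2 ^ S d))]
      · rw [← Finset.sum_filter, Finset.sum_const, nsmul_eq_mul, cnt_eq_card]
        congr 3
        refine Finset.filter_congr fun k hk => ?_
        simp [ok, Finset.mem_range.1 hk]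
      · intro k hk
        have : ok d k = false := by
          have : ¬ k < 2 ^ S d := by simpa using hk
          simp [ok, this]
        simp [this]
    have hpair : Summable fun p : ℕ × ℕ => if ok p.1 p.2 = true then
        ((1 : ℝ) / 2) ^ S p.1 else 0 := by
      rw [summable_prod_of_nonneg (fun p => by dsimp only; split_ifs <;> simp)]
      refine ⟨hinner, ?_⟩
      refine Summable.of_nonneg_of_le (fun d => ?_) (fun d => ?_) summable_geometric_two
      · exact tsum_nonneg fun k => by dsimp only; split_ifs <;> simp
      · rw [hval]
        have h := hSs d
        have h' : (cnt (TT f (S d)) (S d) : ℝ) * 2 ^ d ≤ 2 ^ S d := by exact_mod_cast h.le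
        rw [one_div, inv_pow, inv_pow, ← div_eq_mul_inv, div_le_iff₀ (by positivity),
          inv_mul_eq_div, le_div_iff₀ (by positivity)]
        exact h'
    have := (Nat.pairEquiv.symm.summable_iff).2 hpair
    exact this
  have hsum : Summable fun j => ((1 : ℝ) / 2) ^ (σ j).length := by
    refine Summable.of_nonneg_of_le (fun j => by positivity) (fun j => ?_)
      (hsum1.add summable_geometric_two)
    simp only [σ]
    cases ok j.unpair.1 j.unpair.2 <;> simp [restr_length]
  have hfin := hr σ hσ hsum
  have hk : ∀ d, ∃ k, InitSeg (σ (Nat.pair d k)) Z := by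
    intro d
    obtain ⟨k, hk, hb⟩ := exists_bits Z (S d)
    refine ⟨k, ?_⟩
    have hT : TT f (S d) k = true := by
      rw [TT_iff]
      intro i _ ρ hρ hl heq
      rw [hb _ hl] at heq
      exact hZ i ρ hρ heq
    simp only [σ, Nat.unpair_pair, ok, hk, hT, decide_true, Bool.and_true, cond_true]
    unfold InitSeg
    rw [restr_length, hb _ le_rfl]
  choose g hg using hk
  refine Set.infinite_of_injective_forall_mem (f := fun d => Nat.pair d (g d)) ?_ hg hfin
  intro a b h
  exact (Nat.pair_eq_pair.1 h).1


/-! ### The requirement sets -/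

open Nat.Partrec (Code)

theorem exists_X (c : ℕ → ℕ → ℚ) (hc : CostFunction c) (hlim : LimitCondition c) (q : ℕ → ℕ)
    (hq : Computable q) : ∃ X : ℕ → ℕ → ℕ, Computable₂ X ∧
      (∀ n s, c (X n s) s ≤ (1 / 2) ^ q n) ∧ (∀ n s s', s ≤ s' → X n s ≤ X n s') ∧
      ∀ n, ∃ B, ∀ s, X n s ≤ B := by
  obtain ⟨hcc, h0, hm, ha⟩ := hc
  have hB : ∀ n, ∃ B, ∀ s, c B s ≤ (1 / 2) ^ q n := by
    intro n
    obtain ⟨B, hB⟩ := hlim ((1 / 2) ^ q n) (by positivity)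
    exact ⟨B, fun s => hB B le_rfl s⟩
  have hex : ∀ w : ℕ × ℕ, ∃ x, decide (c x w.2 ≤ (1 / 2) ^ q w.1) = true := by
    intro w
    obtain ⟨B, hB⟩ := hB w.1
    exact ⟨B, by simpa using hB w.2⟩
  have hp : Computable₂ fun (w : ℕ × ℕ) (x : ℕ) => decide (c x w.2 ≤ (1 / 2) ^ q w.1) := by
    have h1 : Computable fun v : (ℕ × ℕ) × ℕ => c v.2 v.1.2 :=
      hcc.comp Computable.snd (Computable.snd.comp Computable.fst)
    have h2 : Computable fun v : (ℕ × ℕ) × ℕ => q v.1.1 :=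
      hq.comp (Computable.fst.comp Computable.fst)
    exact comp_rat_le h1 h2 (fun v => h0 _ _)
  have hspec : ∀ n s, c (Nat.find (hex (n, s))) s ≤ (1 / 2) ^ q n := fun n s => by
    simpa using Nat.find_spec (hex (n, s))
  refine ⟨fun n s => Nat.find (hex (n, s)), comp_find hp hex, hspec, ?_, ?_⟩
  · intro n s s' h
    refine Nat.find_min' _ (decide_eq_true ?_)
    exact (hm _ s s' h).trans (hspec n s')
  · intro n
    obtain ⟨B, hB⟩ := hB n
    refine ⟨B, fun s => Nat.find_min' _ ?_⟩
    simpa using hB s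

/-- step-bounded evaluation of the `e`-th code. -/
def ev (e s y : ℕ) : Option ℕ := Code.evaln s (Denumerable.ofNat Code e) y

theorem ev_mono {e s s' y v : ℕ} (h : s ≤ s') (hv : ev e s y = some v) : ev e s' y = some v :=
  Code.evaln_mono h hv

theorem comp_ev {α : Type*} [Primcodable α] {e s y : α → ℕ} (he : Computable e)
    (hs : Computable s) (hy : Computable y) : Computable fun a => ev (e a) (s a) (y a) :=
  (Code.primrec_evaln.to_comp).comp
    (Computable.pair (Computable.pair hs ((Computable.ofNat Code).comp he)) hy)

/-- the stage-`s` approximation of the `a`-th c.e. set. -/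
def Vb (a s x : ℕ) : Bool := (ev a s x).isSome

theorem Vb_mono {a s s' x : ℕ} (h : s ≤ s') (hv : Vb a s x = true) : Vb a s' x = true := by
  unfold Vb at *
  rw [Option.isSome_iff_exists] at *
  obtain ⟨v, hv⟩ := hv
  exact ⟨v, ev_mono h hv⟩

theorem comp_Vb {α : Type*} [Primcodable α] {e s y : α → ℕ} (he : Computable e)
    (hs : Computable s) (hy : Computable y) : Computable fun a => Vb (e a) (s a) (y a) :=
  (Primrec.option_isSome.to_comp).comp (comp_ev he hs hy)

/-- test that the computation with oracle `k ↾ m` agrees with the c.e. set at `x`. -/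
def agr (n s k m x : ℕ) : Bool :=
  decide (ev n.unpair.1.unpair.2 s (Encodable.encode (restr k.testBit m, x)) =
    some (bif Vb n.unpair.1.unpair.1 s x then 1 else 0))

theorem comp_agr : Computable fun w : (((ℕ × ℕ) × ℕ) × ℕ) × ℕ =>
    agr w.1.1.1.1 w.1.1.1.2 w.1.1.2 w.1.2 w.2 := by
  have v1 : Computable fun w : (((ℕ × ℕ) × ℕ) × ℕ) × ℕ => w.1.1.1.1 :=
    Computable.fst.comp (Computable.fst.comp (Computable.fst.comp Computable.fst))
  have v2 : Computable fun w : (((ℕ × ℕ) × ℕ) × ℕ) × ℕ => w.1.1.1.2 :=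
    Computable.snd.comp (Computable.fst.comp (Computable.fst.comp Computable.fst))
  have v3 : Computable fun w : (((ℕ × ℕ) × ℕ) × ℕ) × ℕ => w.1.1.2 :=
    Computable.snd.comp (Computable.fst.comp Computable.fst)
  have v4 : Computable fun w : (((ℕ × ℕ) × ℕ) × ℕ) × ℕ => w.1.2 :=
    Computable.snd.comp Computable.fst
  have v5 : Computable fun w : (((ℕ × ℕ) × ℕ) × ℕ) × ℕ => w.2 := Computable.snd
  have e1 : Computable fun n : ℕ => n.unpair.1 := Computable.fst.comp Computable.unpair
  have e2 : Computable fun n : ℕ => n.unpair.2 := Computable.snd.comp Computable.unpair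
  have r1 : Computable fun w : (((ℕ × ℕ) × ℕ) × ℕ) × ℕ => restr w.1.1.2.testBit w.1.2 :=
    comp_restr_bits v3 v4
  have r2 : Computable fun w : (((ℕ × ℕ) × ℕ) × ℕ) × ℕ =>
      Encodable.encode (restr w.1.1.2.testBit w.1.2, w.2) :=
    Computable.encode.comp (Computable.pair r1 v5)
  have ca : Computable fun w : (((ℕ × ℕ) × ℕ) × ℕ) × ℕ => w.1.1.1.1.unpair.1.unpair.1 :=
    e1.comp (e1.comp v1)
  have cb : Computable fun w : (((ℕ × ℕ) × ℕ) × ℕ) × ℕ => w.1.1.1.1.unpair.1.unpair.2 :=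
    e2.comp (e1.comp v1)
  have t1 := comp_ev cb v2 r2
  have t2 := comp_Vb ca v2 v5
  have t3 : Computable fun w : (((ℕ × ℕ) × ℕ) × ℕ) × ℕ =>
      some (bif Vb w.1.1.1.1.unpair.1.unpair.1 w.1.1.1.2 w.2 then 1 else 0) :=
    Computable.option_some.comp (Computable.cond t2 (Computable.const 1) (Computable.const 0))
  exact comp_eq t1 t3

def GG (X : ℕ → ℕ → ℕ) (n s k : ℕ) : Bool :=
  decide (∃ m < s + 1, decide (∀ x < X n s, agr n s k m x = true) = true)

theorem GG_iff (X : ℕ → ℕ → ℕ) (n s k : ℕ) : GG X n s k = true ↔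
    ∃ m ≤ s, ∀ x < X n s, agr n s k m x = true := by
  simp [GG]

theorem comp_GG (X : ℕ → ℕ → ℕ) (hX : Computable₂ X) :
    Computable fun q : ℕ × ℕ × ℕ => GG X q.1 q.2.1 q.2.2 := by
  have h1 : Computable fun w : ((ℕ × ℕ) × ℕ) × ℕ => X w.1.1.1 w.1.1.2 :=
    hX.comp (Computable.fst.comp (Computable.fst.comp Computable.fst))
      (Computable.snd.comp (Computable.fst.comp Computable.fst))
  have h0 : Computable₂ fun (w : ((ℕ × ℕ) × ℕ) × ℕ) (x : ℕ) =>
      agr w.1.1.1 w.1.1.2 w.1.2 w.2 x := comp_agr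
  have h2 : Computable fun w : ((ℕ × ℕ) × ℕ) × ℕ =>
      decide (∀ x < X w.1.1.1 w.1.1.2, agr w.1.1.1 w.1.1.2 w.1.2 w.2 x = true) :=
    comp_ball (p := fun (w : ((ℕ × ℕ) × ℕ) × ℕ) x => agr w.1.1.1 w.1.1.2 w.1.2 w.2 x) h0 h1
  have h3 : Computable fun w : (ℕ × ℕ) × ℕ => w.1.2 + 1 :=
    comp_add (Computable.snd.comp Computable.fst) (Computable.const 1)
  have h4 : Computable fun w : (ℕ × ℕ) × ℕ => GG X w.1.1 w.1.2 w.2 :=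
    comp_bex (p := fun (w : (ℕ × ℕ) × ℕ) m =>
      decide (∀ x < X w.1.1 w.1.2, agr w.1.1 w.1.2 w.2 m x = true)) h2 h3
  have h5 : Computable fun q : ℕ × ℕ × ℕ => ((q.1, q.2.1), q.2.2) :=
    Computable.pair (Computable.pair Computable.fst (Computable.fst.comp Computable.snd))
      (Computable.snd.comp Computable.snd)
  exact Computable.comp (f := fun w : (ℕ × ℕ) × ℕ => GG X w.1.1 w.1.2 w.2)
    (g := fun q : ℕ × ℕ × ℕ => ((q.1, q.2.1), q.2.2)) h4 h5

theorem bool_stable (h : ℕ → Bool) (hm : ∀ s s', s ≤ s' → h s = true → h s' = true) :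
    ∃ t, ∀ s, t ≤ s → h s = h t := by
  by_cases hx : ∃ s, h s = true
  · obtain ⟨t, ht⟩ := hx
    exact ⟨t, fun s hs => by rw [ht, hm t s hs ht]⟩
  · push Not at hx
    exact ⟨0, fun s _ => by rw [Bool.eq_false_iff.2 (hx s), Bool.eq_false_iff.2 (hx 0)]⟩

theorem nat_stable (h : ℕ → ℕ) (hm : ∀ s s', s ≤ s' → h s ≤ h s') (hB : ∃ B, ∀ s, h s ≤ B) :
    ∃ t, ∀ s, t ≤ s → h s = h t := by
  obtain ⟨B, hB⟩ := hB
  by_contra hcon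
  push Not at hcon
  have : ∀ n, ∃ s, n ≤ h s := by
    intro n
    induction n with
    | zero => exact ⟨0, Nat.zero_le _⟩
    | succ n ih =>
      obtain ⟨s, hs⟩ := ih
      obtain ⟨s', h1, h2⟩ := hcon s
      have := hm s s' h1
      exact ⟨s', by omega⟩
  obtain ⟨s, hs⟩ := this (B + 1)
  have := hB s
  omega

theorem Vb_stable (a N : ℕ) : ∃ t, ∀ s, t ≤ s → ∀ x < N, Vb a s x = Vb a t x := by
  induction N with
  | zero => exact ⟨0, fun _ _ x hx => absurd hx (by omega)⟩
  | succ N ih =>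
    obtain ⟨t1, h1⟩ := ih
    obtain ⟨t2, h2⟩ := bool_stable (fun s => Vb a s N) fun s s' h => Vb_mono h
    refine ⟨max t1 t2, fun s hs x hx => ?_⟩
    rcases Nat.lt_succ_iff_lt_or_eq.1 hx with hx | rfl
    · rw [h1 s (by omega) x hx, h1 (max t1 t2) (by omega) x hx]
    · have e1 := h2 s (by omega)
      have e2 := h2 (max t1 t2) (by omega)
      exact e1.trans e2.symm

theorem agr_stable {n s s' k k' m x : ℕ} (hs : s ≤ s')
    (hV : Vb n.unpair.1.unpair.1 s x = Vb n.unpair.1.unpair.1 s' x)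
    (hk : restr k.testBit m = restr k'.testBit m) (h : agr n s k m x = true) :
    agr n s' k' m x = true := by
  unfold agr at *
  rw [decide_eq_true_eq] at *
  rw [← hk, ← hV]
  exact ev_mono hs h

theorem GG_mono (X : ℕ → ℕ → ℕ) (hm : ∀ n s s', s ≤ s' → X n s ≤ X n s')
    (hB : ∀ n, ∃ B, ∀ s, X n s ≤ B) (n : ℕ) :
    ∃ t, ∀ s, t ≤ s → ∀ k, GG X n s (k % 2 ^ s) = true → GG X n (s + 1) k = true := by
  obtain ⟨t1, h1⟩ := nat_stable (X n) (hm n) (hB n)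
  obtain ⟨t2, h2⟩ := Vb_stable n.unpair.1.unpair.1 (X n t1)
  refine ⟨max t1 t2, fun s hs k h => ?_⟩
  rw [GG_iff] at h ⊢
  obtain ⟨m, hms, h⟩ := h
  refine ⟨m, by omega, fun x hx => ?_⟩
  rw [h1 (s + 1) (by omega)] at hx
  rw [h1 s (by omega)] at h
  refine agr_stable (Nat.le_succ s) ?_ (restr_mod k hms) (h x hx)
  rw [h2 s (by omega) x hx, h2 (s + 1) (by omega) x hx]


/-! ### Obedience -/

open Nat.Partrec (Code)

theorem ev_all (L : ℕ) (p : ℕ → ℕ → Prop) (h : ∀ x < L, ∃ t, ∀ s, t ≤ s → p x s) :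
    ∃ t, ∀ s, t ≤ s → ∀ x < L, p x s := by
  induction L with
  | zero => exact ⟨0, fun _ _ x hx => absurd hx (by omega)⟩
  | succ N ih =>
    obtain ⟨t1, h1⟩ := ih fun x hx => h x (by omega)
    obtain ⟨t2, h2⟩ := h N (by omega)
    refine ⟨max t1 t2, fun s hs x hx => ?_⟩
    rcases Nat.lt_succ_iff_lt_or_eq.1 hx with hx | rfl
    · exact h1 s (by omega) x hx
    · exact h2 s (by omega)

theorem geom_le_two (N : ℕ) : ∑ j ∈ Finset.range N, ((1 : ℚ) / 2) ^ j ≤ 2 := by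
  have : ∑ j ∈ Finset.range N, ((1 : ℚ) / 2) ^ j = 2 - 2 * (1 / 2) ^ N := by
    induction N with
    | zero => simp
    | succ N ih => rw [Finset.sum_range_succ, ih, pow_succ]; ring
  rw [this]
  have : (0 : ℚ) < (1 / 2) ^ N := by positivity
  linarith

open Classical in
theorem sum_bound (w : ℕ → ℚ) (h0 : ∀ j, 0 ≤ w j) (E : ℕ → Set ℕ) (D : ℕ → ℕ)
    (hle : ∀ i, ∀ j ∈ E i, i ≤ j)
    (hE : ∀ i (F : Finset ℕ), (F : Set ℕ) ⊆ E i → F.card ≤ 2 ^ D i)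
    (hw : ∀ j, w j ≤ (1 / 2) ^ j ∨ j ∈ E 0 ∨
      ∃ i, j ∈ E (i + 1) ∧ w j ≤ (1 / 2) ^ (D (i + 1) + (i + 1))) :
    ∃ B, ∀ N, ∑ j ∈ Finset.range N, w j ≤ B := by
  have hfin : (E 0).Finite := by
    by_contra hinf
    obtain ⟨F, hF, hc⟩ := Set.Infinite.exists_subset_card_eq hinf (2 ^ D 0 + 1)
    have := hE 0 F hF
    omega
  refine ⟨2 + ∑ j ∈ hfin.toFinset, w j + 2, fun N => ?_⟩
  have hterm : ∀ j ∈ Finset.range N, w j ≤ (1 / 2) ^ j + (if j ∈ E 0 then w j else 0) +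
      ∑ i ∈ Finset.range N,
        (if j ∈ E (i + 1) then ((1 : ℚ) / 2) ^ (D (i + 1) + (i + 1)) else 0) := by
    intro j hj
    have p1 : (0 : ℚ) ≤ (1 / 2) ^ j := by positivity
    have p2 : 0 ≤ (if j ∈ E 0 then w j else 0) := by split_ifs; exacts [h0 j, le_rfl]
    have p3 : ∀ i ∈ Finset.range N,
        0 ≤ (if j ∈ E (i + 1) then ((1 : ℚ) / 2) ^ (D (i + 1) + (i + 1)) else 0) := by
      intro i _
      split_ifs
      · positivity
      · exact le_rfl
    have p4 := Finset.sum_nonneg p3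
    rcases hw j with h | h | ⟨i, hi, h⟩
    · linarith
    · rw [if_pos h] at p2 ⊢
      linarith
    · have hiN : i ∈ Finset.range N := by
        have := hle _ j hi
        rw [Finset.mem_range] at hj ⊢
        omega
      have := Finset.single_le_sum p3 hiN
      rw [if_pos hi] at this
      linarith
  refine (Finset.sum_le_sum hterm).trans ?_
  rw [Finset.sum_add_distrib, Finset.sum_add_distrib, Finset.sum_comm]
  refine add_le_add (add_le_add (geom_le_two N) ?_) ?_
  · rw [← Finset.sum_filter]
    refine Finset.sum_le_sum_of_subset_of_nonneg (fun j hj => ?_) fun j _ _ => h0 j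
    simpa using (Finset.mem_filter.1 hj).2
  · refine le_trans (Finset.sum_le_sum (g := fun i => ((1 : ℚ) / 2) ^ i) fun i _ => ?_)
      (geom_le_two N)
    rw [← Finset.sum_filter, Finset.sum_const, nsmul_eq_mul]
    have hc := hE (i + 1) ((Finset.range N).filter fun j => j ∈ E (i + 1))
      (fun j hj => (Finset.mem_filter.1 hj).2)
    have hc' : (((Finset.range N).filter fun j => j ∈ E (i + 1)).card : ℚ) ≤ 2 ^ D (i + 1) := by
      exact_mod_cast hc
    calc _ ≤ (2 : ℚ) ^ D (i + 1) * (1 / 2) ^ (D (i + 1) + (i + 1)) := by gcongr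
      _ = (1 / 2) ^ (i + 1) := by
        rw [pow_add, ← mul_assoc, ← mul_pow]; norm_num
      _ ≤ (1 / 2) ^ i := pow_le_pow_of_le_one (by norm_num) (by norm_num) (Nat.le_succ i)

theorem stageCost_succ (c : ℕ → ℕ → ℚ) (As : ℕ → ℕ → Bool) (j : ℕ) :
    (∃ x, stageCost c As (j + 1) = c x (j + 1) ∧ As (j + 1) x ≠ As j x) ∨
      stageCost c As (j + 1) = 0 := by
  by_cases h : ∃ x, As (j + 1) x ≠ As (j + 1 - 1) x
  · left
    classical
    refine ⟨Nat.find h, ?_, Nat.find_spec h⟩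
    unfold stageCost
    rw [if_neg (by omega), dif_pos h]
  · right
    unfold stageCost
    rw [if_neg (by omega), dif_neg h]

theorem disj_G (X : ℕ → ℕ → ℕ) (hm : ∀ n s s', s ≤ s' → X n s ≤ X n s') (n : ℕ)
    (ψ : List Bool → ℕ → Option ℕ)
    (hψ : ∀ τ τ' x v, τ <+: τ' → ψ τ x = some v → ψ τ' x = some v)
    (hb : ∀ s τ x v, ev n.unpair.1.unpair.2 s (Encodable.encode (τ, x)) = some v →
      ψ τ x = some v) {u u' k x : ℕ} (huu : u ≤ u') (hx : x < X n u)
    (h0 : Vb n.unpair.1.unpair.1 u x = false) (h1 : Vb n.unpair.1.unpair.1 u' x = true)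
    (hG : GG X n u (k % 2 ^ u) = true) (hG' : GG X n u' (k % 2 ^ u') = true) : False := by
  rw [GG_iff] at hG hG'
  obtain ⟨m, hmu, hG⟩ := hG
  obtain ⟨m', hmu', hG'⟩ := hG'
  have g0 := hG x hx
  have g1 := hG' x (lt_of_lt_of_le hx (hm n u u' huu))
  unfold agr at g0 g1
  rw [decide_eq_true_eq, restr_mod k hmu, h0] at g0
  rw [decide_eq_true_eq, restr_mod k hmu', h1] at g1
  have f0 := hb _ _ _ _ g0
  have f1 := hb _ _ _ _ g1
  have a0 := hψ _ _ _ _ (restr_pre_of_le k.testBit (le_max_left m m')) f0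
  have a1 := hψ _ _ _ _ (restr_pre_of_le k.testBit (le_max_right m m')) f1
  rw [a0] at a1
  simp at a1

theorem count_E (D : ℕ) (H : ℕ → ℕ → Bool) (S : ℕ → ℕ) (F : Finset ℕ)
    (hbig : ∀ j ∈ F, 2 ^ S j < cnt (H (S j)) (S j) * 2 ^ D)
    (hdisj : ∀ j ∈ F, ∀ j' ∈ F, j < j' → ∀ k, H (S j) (k % 2 ^ S j) = true →
      H (S j') (k % 2 ^ S j') = true → False) : F.card ≤ 2 ^ D := by
  set s := F.sup S with hs
  have hle : ∀ j ∈ F, S j ≤ s := fun j hj => Finset.le_sup hj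
  let C : ℕ → Finset ℕ := fun j => (Finset.range (2 ^ s)).filter
    fun k => H (S j) (k % 2 ^ S j) = true
  have hC : ∀ j ∈ F, (C j).card = 2 ^ (s - S j) * cnt (H (S j)) (S j) := by
    intro j hj
    rw [← cnt_pull (H (S j)) (S j) (hle j hj), cnt_eq_card]
  have hpd : ∀ j ∈ F, ∀ j' ∈ F, j ≠ j' → Disjoint (C j) (C j') := by
    intro j hj j' hj' hne
    rw [Finset.disjoint_left]
    intro k hk hk'
    have h1 := (Finset.mem_filter.1 hk).2
    have h2 := (Finset.mem_filter.1 hk').2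
    rcases lt_or_gt_of_ne hne with h | h
    · exact hdisj j hj j' hj' h k h1 h2
    · exact hdisj j' hj' j hj h k h2 h1
  have hsum : ∑ j ∈ F, (C j).card ≤ 2 ^ s := by
    rw [← Finset.card_biUnion hpd]
    refine (Finset.card_le_card (t := Finset.range (2 ^ s)) ?_).trans (by simp)
    exact Finset.biUnion_subset.2 fun j _ => Finset.filter_subset _ _
  have hbig' : ∀ j ∈ F, 2 ^ s ≤ (C j).card * 2 ^ D := by
    intro j hj
    have h := hbig j hj
    rw [hC j hj, mul_assoc]
    calc 2 ^ s = 2 ^ (s - S j) * 2 ^ S j := by rw [← pow_add, Nat.sub_add_cancel (hle j hj)]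
      _ ≤ _ := Nat.mul_le_mul_left _ h.le
  have h1 : F.card * 2 ^ s ≤ 2 ^ s * 2 ^ D := by
    calc F.card * 2 ^ s = ∑ j ∈ F, 2 ^ s := by simp
      _ ≤ ∑ j ∈ F, (C j).card * 2 ^ D := Finset.sum_le_sum hbig'
      _ = (∑ j ∈ F, (C j).card) * 2 ^ D := by rw [Finset.sum_mul]
      _ ≤ _ := Nat.mul_le_mul_right _ hsum
  rw [mul_comm] at h1
  exact Nat.le_of_mul_le_mul_left h1 (by positivity)

/-- the precision used by requirement `n`. -/
def prec (d n : ℕ) : ℕ :=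
  2 * Nat.pair n.unpair.1 (n.unpair.2 + 1) + d + 1 + (n.unpair.2 + 1)

theorem comp_prec (d : ℕ) : Computable (prec d) := by
  have e1 : Computable fun n : ℕ => n.unpair.1 := Computable.fst.comp Computable.unpair
  have e2 : Computable fun n : ℕ => n.unpair.2 + 1 :=
    comp_add (Computable.snd.comp Computable.unpair) (Computable.const 1)
  have e3 : Computable fun n : ℕ => Nat.pair n.unpair.1 (n.unpair.2 + 1) := comp_pair e1 e2
  exact comp_add (comp_add (comp_add (comp_mul (Computable.const 2) e3) (Computable.const d))
    (Computable.const 1)) e2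

theorem obeys_of (c : ℕ → ℕ → ℚ) (hc : CostFunction c) (d : ℕ) (X : ℕ → ℕ → ℕ)
    (hXc : Computable₂ X) (hX : ∀ n s, c (X n s) s ≤ (1 / 2) ^ prec d n)
    (hm : ∀ n s s', s ≤ s' → X n s ≤ X n s') (a b : ℕ) (A : ℕ → Bool)
    (hA : ∀ x, A x = true ↔ ∃ s, Vb a s x = true)
    (ψ : List Bool → ℕ → Option ℕ)
    (hψ : ∀ τ τ' x v, τ <+: τ' → ψ τ x = some v → ψ τ' x = some v)
    (hb : ∀ s τ x v, ev b s (Encodable.encode (τ, x)) = some v → ψ τ x = some v)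
    (hev : ∀ i, ∃ t, ∀ s, t ≤ s → 2 ^ s < cnt (GG X (Nat.pair (Nat.pair a b) i) s) s *
      2 ^ (2 * Nat.pair (Nat.pair a b) i + d + 1)) : Obeys A c := by
  obtain ⟨-, hc0, hcm, hca⟩ := hc
  set n : ℕ → ℕ := fun i => Nat.pair (Nat.pair a b) i with hn
  let D : ℕ → ℕ := fun i => 2 * n i + d + 1
  let ok : ℕ → ℕ → Bool := fun s i => decide (2 ^ s < cnt (GG X (n i) s) s * 2 ^ D i)
  have hok : Computable₂ ok := by
    have n1 : Computable n := comp_pair (Computable.const _) Computable.id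
    have n2 : Computable fun w : ℕ × ℕ => n w.2 := n1.comp Computable.snd
    have g : Computable fun w : (ℕ × ℕ) × ℕ => GG X (n w.1.2) w.1.1 w.2 :=
      comp3 (GG X) (comp_GG X hXc) _ _ _ (n2.comp Computable.fst)
        (Computable.fst.comp Computable.fst) Computable.snd
    have g1 : Computable fun w : ℕ × ℕ => cnt (GG X (n w.2) w.1) w.1 :=
      comp_cnt (p := fun (w : ℕ × ℕ) (k : ℕ) => GG X (n w.2) w.1 k) (N := fun w => w.1)
        g Computable.fst
    have g2 : Computable fun w : ℕ × ℕ => 2 ^ D w.2 :=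
      comp_pow (Computable.const 2) (comp_add (comp_add (comp_mul (Computable.const 2) n2)
        (Computable.const d)) (Computable.const 1))
    have g3 : Computable fun w : ℕ × ℕ => 2 ^ w.1 :=
      comp_pow (Computable.const 2) Computable.fst
    exact comp_lt g3 (comp_mul g1 g2)
  have hokall : Computable fun w : ℕ × ℕ => decide (∀ i < w.1 + 1, ok w.2 i = true) := by
    have g1 : Computable fun v : (ℕ × ℕ) × ℕ => ok v.1.2 v.2 :=
      hok.comp (Computable.snd.comp Computable.fst) Computable.snd
    exact comp_ball (p := fun (w : ℕ × ℕ) (i : ℕ) => ok w.2 i) (N := fun w => w.1 + 1) g1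
      (comp_add Computable.fst (Computable.const 1))
  have hp : Computable₂ fun j s : ℕ =>
      decide (j + 1 ≤ s) && decide (∀ i < j + 1, ok s i = true) :=
    comp_and (comp_le (comp_add Computable.fst (Computable.const 1)) Computable.snd) hokall
  have hex : ∀ j, ∃ s, (decide (j + 1 ≤ s) && decide (∀ i < j + 1, ok s i = true)) = true := by
    intro j
    obtain ⟨t, ht⟩ := ev_all (j + 1) (fun i s => ok s i = true) fun i _ => by
      obtain ⟨t, ht⟩ := hev i
      exact ⟨t, fun s hs => decide_eq_true (ht s hs)⟩
    refine ⟨max t (j + 1), ?_⟩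
    rw [Bool.and_eq_true, decide_eq_true_eq, decide_eq_true_eq]
    exact ⟨le_max_right _ _, ht _ (le_max_left _ _)⟩
  have hSc := comp_find hp hex
  have hSspec : ∀ j, j + 1 ≤ Nat.find (hex j) ∧ ∀ i < j + 1, ok (Nat.find (hex j)) i = true := by
    intro j
    have h := Nat.find_spec (hex j)
    rwa [Bool.and_eq_true, decide_eq_true_eq, decide_eq_true_eq] at h
  have hSmin : ∀ j s, j + 1 ≤ s → (∀ i < j + 1, ok s i = true) → Nat.find (hex j) ≤ s := by
    intro j s h1 h2
    refine Nat.find_min' _ ?_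
    rw [Bool.and_eq_true, decide_eq_true_eq, decide_eq_true_eq]
    exact ⟨h1, h2⟩
  generalize hSd : (fun j => Nat.find (hex j)) = S at hSc
  have hS1 : ∀ j, j + 1 ≤ S j := fun j => by subst hSd; exact (hSspec j).1
  have hS2 : ∀ j, ∀ i ≤ j, ok (S j) i = true := fun j i hi => by
    subst hSd; exact (hSspec j).2 i (by omega)
  have hSstep : ∀ j, S j ≤ S (j + 1) := fun j => by
    have h1 := hS1 (j + 1)
    have h2 := hS2 (j + 1)
    have := hSmin j (S (j + 1)) (by omega) (fun i hi => h2 i (by omega))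
    subst hSd
    exact this
  have hSm : Monotone S := monotone_nat_of_le_succ hSstep
  have hna : ∀ i, (n i).unpair.1.unpair.1 = a := fun i => by simp [hn]
  have hnb : ∀ i, (n i).unpair.1.unpair.2 = b := fun i => by simp [hn]
  let As : ℕ → ℕ → Bool := fun j x => Vb a (S j) x
  have hAsm : ∀ j j' x, j ≤ j' → As j x = true → As j' x = true := fun j j' x h h1 =>
    Vb_mono (hSm h) h1
  refine ⟨As, ⟨?_, ?_⟩, ?_⟩
  · exact comp_Vb (Computable.const a) (hSc.comp Computable.fst) Computable.snd
  · intro x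
    by_cases hx : A x = true
    · obtain ⟨s, hs⟩ := (hA x).1 hx
      refine ⟨s, fun j hj => ?_⟩
      rw [hx]
      exact Vb_mono (by have := hS1 j; omega) hs
    · refine ⟨0, fun j _ => ?_⟩
      rw [Bool.eq_false_iff.2 hx, Bool.eq_false_iff]
      exact fun h => hx ((hA x).2 ⟨_, h⟩)
  let E : ℕ → Set ℕ := fun i => {j | i ≤ j ∧ ∃ x < X (n i) (S j), As j x = false ∧
    As (j + 1) x = true}
  have hcost0 : ∀ s, 0 ≤ stageCost c As s := by
    intro s
    unfold stageCost
    split_ifs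
    · exact le_rfl
    · exact hc0 _ _
    · exact le_rfl
  have hEc : ∀ i (F : Finset ℕ), (F : Set ℕ) ⊆ E i → F.card ≤ 2 ^ D i := by
    intro i F hF
    refine count_E (D i) (GG X (n i)) S F (fun j hj => ?_) ?_
    · exact of_decide_eq_true (hS2 j i (hF hj).1)
    · intro j hj j' _ hlt k h1 h2
      obtain ⟨_, x, hx, x0, x1⟩ := hF hj
      refine disj_G X hm (n i) ψ hψ ?_ (hSm hlt.le) hx ?_ ?_ h1 h2
      · rw [hnb]; exact hb
      · rw [hna]; exact x0
      · rw [hna]; exact hAsm _ _ _ hlt x1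
  obtain ⟨B, hB⟩ := sum_bound (fun j => stageCost c As (j + 1)) (fun j => hcost0 _) E D
    (fun i j h => h.1) hEc (by
      intro j
      rcases stageCost_succ c As j with ⟨x, hsc, hx⟩ | hsc
      · rw [hsc]
        have x0 : As j x = false := by
          rw [Bool.eq_false_iff]
          intro h1
          exact hx (by rw [h1, hAsm j (j + 1) x (by omega) h1])
        have x1 : As (j + 1) x = true := by
          rw [x0] at hx
          simpa using hx
        have hcx : ∀ i, X (n i) (S j) ≤ x →
            c x (j + 1) ≤ (1 / 2) ^ (D (i + 1) + (i + 1)) := by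
          intro i hi
          have e : prec d (n i) = D (i + 1) + (i + 1) := by simp [prec, hn, D]
          rw [← e]
          exact ((hcm x _ _ (hS1 j)).trans (hca _ _ _ hi)).trans (hX (n i) (S j))
        by_cases hi : ∃ i, i ≤ j ∧ x < X (n i) (S j)
        · have hi1 := Nat.find_spec hi
          have hi2 : ∀ i', i' < Nat.find hi → ¬ (i' ≤ j ∧ x < X (n i') (S j)) :=
            fun i' h => Nat.find_min hi h
          generalize Nat.find hi = i at hi1 hi2
          cases i with
          | zero => exact Or.inr (Or.inl ⟨hi1.1, x, hi1.2, x0, x1⟩)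
          | succ i =>
            refine Or.inr (Or.inr ⟨i, ⟨hi1.1, x, hi1.2, x0, x1⟩, hcx i ?_⟩)
            have := hi2 i (by omega)
            by_contra hcon
            exact this ⟨by omega, by omega⟩
        · left
          refine (hcx j ?_).trans (pow_le_pow_of_le_one (by norm_num) (by norm_num) (by omega))
          by_contra hcon
          exact hi ⟨j, le_rfl, by omega⟩
      · left
        rw [hsc]
        positivity)
  refine ⟨B, fun F => ?_⟩
  obtain ⟨M, hM⟩ : ∃ M, F ⊆ Finset.range (M + 1) :=
    ⟨F.sup id, fun x hx => Finset.mem_range.2 (Nat.lt_succ_of_le (Finset.le_sup (f := id) hx))⟩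
  refine (Finset.sum_le_sum_of_subset_of_nonneg hM fun s _ _ => hcost0 s).trans ?_
  rw [Finset.sum_range_succ']
  have : stageCost c As 0 = 0 := by simp [stageCost]
  rw [this, add_zero]
  exact hB M


open Nat.Partrec (Code)

theorem ce_code (A : ℕ → Bool) (hA : CE A) : ∃ a, ∀ x, A x = true ↔ ∃ s, Vb a s x = true := by
  obtain ⟨f, hf, h⟩ := hA
  obtain ⟨cd, rfl⟩ := Code.exists_code.1 hf
  refine ⟨Encodable.encode cd, fun x => ?_⟩
  rw [h, Part.dom_iff_mem]
  simp only [Vb, ev, Denumerable.ofNat_encode, Option.isSome_iff_exists]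
  constructor
  · rintro ⟨v, hv⟩
    obtain ⟨s, hs⟩ := Code.evaln_complete.1 hv
    exact ⟨s, v, hs⟩
  · rintro ⟨s, v, hv⟩
    exact ⟨v, Code.evaln_sound hv⟩

theorem use_code (ψ : List Bool → ℕ → Option ℕ) (hψ : Computable₂ ψ) :
    ∃ b, ∀ τ x v, ψ τ x = some v ↔ ∃ s, ev b s (Encodable.encode (τ, x)) = some v := by
  have hp : Partrec fun w : List Bool × ℕ => (ψ w.1 w.2 : Part ℕ) :=
    Computable.ofOption (f := fun w : List Bool × ℕ => ψ w.1 w.2) hψ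
  obtain ⟨cd, hcd⟩ := Code.exists_code.1 hp
  refine ⟨Encodable.encode cd, fun τ x v => ?_⟩
  have h1 : v ∈ cd.eval (Encodable.encode (τ, x)) ↔ ψ τ x = some v := by
    rw [hcd]
    simp [Encodable.encodek]
  rw [← h1]
  simp only [ev, Denumerable.ofNat_encode]
  exact Code.evaln_complete

theorem main_aux (P : Set (ℕ → Bool)) (hP : Pi01 P)
    (hne : P.Nonempty) (hrand : ∀ Z ∈ P, MLRandom Z)
    (c : ℕ → ℕ → ℚ) (hc : CostFunction c) (hlim : LimitCondition c) :
    ∃ Z ∈ P, Delta02 Z ∧ ∀ A : ℕ → Bool, CE A → TuringLE A Z → Obeys A c := by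
  obtain ⟨f, hf, rfl⟩ := hP
  obtain ⟨Y, hY⟩ := hne
  obtain ⟨d, hd⟩ := positive_measure f hf Y hY (hrand Y hY)
  obtain ⟨X, hXc, hX, hm, hB⟩ := exists_X c hc hlim (prec d) (comp_prec d)
  obtain ⟨Z, hZ, hforce⟩ := forcing (TT f) (GG X) d (comp_TT f hf) (comp_GG X hXc) (TT_mono f)
    (GG_mono X hm hB) hd
  refine ⟨Z, ?_, hZ, ?_⟩
  · intro i σ hσ hin
    obtain ⟨t, ht⟩ := hforce σ.length
    obtain ⟨k, hk, hr, -⟩ := ht (max t (max σ.length (i + 1))) (le_max_left _ _)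
    rw [TT_iff] at hk
    refine hk i (by omega) σ hσ (by omega) ?_
    rw [hr]
    exact hin
  · intro A hA hAZ
    obtain ⟨a, ha⟩ := ce_code A hA
    obtain ⟨ψ, hψc, hψm, hψ⟩ := exists_use Z hAZ
    obtain ⟨b, hb⟩ := use_code ψ hψc
    refine obeys_of c hc d X hXc hX hm a b A ha ψ hψm (fun s τ x v h => (hb τ x v).2 ⟨s, h⟩) ?_
    intro i
    set n := Nat.pair (Nat.pair a b) i with hn
    have hna : n.unpair.1.unpair.1 = a := by simp [hn]
    have hnb : n.unpair.1.unpair.2 = b := by simp [hn]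
    obtain ⟨t1, h1⟩ := nat_stable (X n) (hm n) (hB n)
    obtain ⟨M, hM⟩ := ev_all (X n t1) (fun x m => ψ (restr Z m) x = some (bif A x then 1 else 0))
      (fun x _ => hψ x _ (by simp [charFn]))
    obtain ⟨t2, h2⟩ := ev_all (X n t1) (fun x s => Vb a s x = A x) (fun x _ => by
      by_cases hx : A x = true
      · obtain ⟨s, hs⟩ := (ha x).1 hx
        exact ⟨s, fun s' h => by rw [hx]; exact Vb_mono h hs⟩
      · refine ⟨0, fun s _ => ?_⟩
        rw [Bool.eq_false_iff.2 hx, Bool.eq_false_iff]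
        exact fun h => hx ((ha x).2 ⟨s, h⟩))
    set m := max M (n + 1) with hmdef
    obtain ⟨t3, h3⟩ := ev_all (X n t1)
      (fun x s => ev b s (Encodable.encode (restr Z m, x)) = some (bif A x then 1 else 0))
      (fun x hx => by
        obtain ⟨s, hs⟩ := (hb _ _ _).1 (hM m (le_max_left _ _) x hx)
        exact ⟨s, fun s' h => ev_mono h hs⟩)
    obtain ⟨t4, h4⟩ := hforce m
    refine ⟨t1 + t2 + t3 + t4 + m, fun s hs => ?_⟩
    obtain ⟨k, -, hr, hk⟩ := h4 s (by omega)
    by_contra hcon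
    have hfalse := hk n (by omega) (not_lt.1 hcon)
    have htrue : GG X n s k = true := by
      rw [GG_iff]
      refine ⟨m, by omega, fun x hx => ?_⟩
      rw [h1 s (by omega)] at hx
      unfold agr
      rw [decide_eq_true_eq, hna, hnb, hr, h2 s (by omega) x hx]
      exact h3 s (by omega) x hx
    rw [htrue] at hfalse
    simp at hfalse

/-- For a non-empty Π⁰₁ class of ML-random sets and a cost function `c`
with the limit condition, some Δ⁰₂ member `Z` has all its c.e. subsets below it
obeying `c`. -/
theorem pi01_random_member_forcing_obedience (P : Set (ℕ → Bool)) (hP : Pi01 P)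
    (hne : P.Nonempty) (hrand : ∀ Z ∈ P, MLRandom Z)
    (c : ℕ → ℕ → ℚ) (hc : CostFunction c) (hlim : LimitCondition c) :
    ∃ Z ∈ P, Delta02 Z ∧ ∀ A : ℕ → Bool, CE A → TuringLE A Z → Obeys A c := by
  exact main_aux P hP hne hrand c hc hlim
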